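/- arXiv:2109.05054 — 3 statements merged into one kernel-verified Lean document; each statement's English description precedes it below -/
import Mathlib

section
/- For every integer d ≥ 1, the subgroup of SL(2, ℤ[√−d]) generated by the upper triangular and lower triangular matrices equals SL(2, ℤ[√−d]) if and only if d ≤ 3. -/
namespace ESub

abbrev SL (d : ℤ) := Matrix.SpecialLinearGroup (Fin 2) (Zsqrtd (-d))

/-- The strictly decreasing pairs. -/
inductive D (d : ℤ) : Zsqrtd (-d) → Zsqrtd (-d) → Prop
  | base (u : Zsqrtd (-d)) (hu : u = 1 ∨ u = -1) : D d u 0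
  | step (a b x s : Zsqrtd (-d)) (h : D d a b) (hx : 4 ≤ x.norm) (hs : s = 1 ∨ s = -1) :
      D d (a * x + b) (s * a)

def R (d : ℤ) (a b : Zsqrtd (-d)) : Prop :=
  ((a = 1 ∨ a = -1) ∧ b = 0) ∨ ∃ c e x, D d c e ∧ a = c * x + e ∧ b = c

lemma norm_eq {d : ℤ} (x : Zsqrtd (-d)) : x.norm = x.re * x.re + d * (x.im * x.im) := by
  rw [Zsqrtd.norm_def]; ring

lemma norm_nonneg' {d : ℤ} (hd : 1 ≤ d) (x : Zsqrtd (-d)) : 0 ≤ x.norm := by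
  rw [norm_eq]; nlinarith [mul_self_nonneg x.re, mul_self_nonneg x.im]

lemma norm_pos' {d : ℤ} (hd : 1 ≤ d) (x : Zsqrtd (-d)) (hx : x ≠ 0) : 0 < x.norm := by
  rw [norm_eq]
  by_contra h
  apply hx
  have h1 := mul_self_nonneg x.re
  have h2 := mul_self_nonneg x.im
  have h3 : x.im * x.im ≤ d * (x.im * x.im) := by nlinarith
  ext
  · exact mul_self_eq_zero.mp (by linarith)
  · exact mul_self_eq_zero.mp (by linarith)

lemma small {d : ℤ} (hd : 4 ≤ d) (x : Zsqrtd (-d)) (hx : x.norm < 4) : x = 0 ∨ x = 1 ∨ x = -1 := by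
  rw [norm_eq] at hx
  have h1 := mul_self_nonneg x.re
  have him : x.im = 0 := by
    by_contra h
    have : 0 < x.im * x.im := mul_self_pos.mpr h
    nlinarith
  have h2 : x.re < 2 := by nlinarith
  have h3 : -2 < x.re := by nlinarith
  have : x.re = 0 ∨ x.re = 1 ∨ x.re = -1 := by omega
  rcases this with h | h | h
  · left; ext <;> simp [h, him]
  · right; left; ext <;> simp [h, him]
  · right; right; ext <;> simp [h, him]

lemma D_sign {d : ℤ} {a b : Zsqrtd (-d)} (h : D d a b) :
    D d a (-b) ∧ D d (-a) b ∧ D d (-a) (-b) := by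
  induction h with
  | base u hu =>
    have hu' : -u = 1 ∨ -u = -1 := by
      rcases hu with rfl | rfl <;> simp
    simp only [neg_zero]
    exact ⟨.base u hu, .base _ hu', .base _ hu'⟩
  | step a b x s h hx hs ih =>
    have hs' : -s = 1 ∨ -s = -1 := by
      rcases hs with rfl | rfl <;> simp
    have hx' : 4 ≤ (-x).norm := by simpa using hx
    refine ⟨?_, ?_, ?_⟩
    · have := D.step a b x (-s) h hx hs'
      convert this using 1; ring
    · have := D.step a (-b) (-x) s ih.1 hx' hs
      convert this using 1; ring
    · have := D.step a (-b) (-x) (-s) ih.1 hx' hs'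
      convert this using 1 <;> ring

lemma D_lt {d : ℤ} (hd : 4 ≤ d) {a b : Zsqrtd (-d)} (h : D d a b) : b.norm < a.norm := by
  induction h with
  | base u hu => rcases hu with rfl | rfl <;> simp [Zsqrtd.norm_def]
  | step a b x s h hx hs ih =>
    have hs1 : s.norm = 1 := by rcases hs with rfl | rfl <;> simp [Zsqrtd.norm_def]
    rw [Zsqrtd.norm_mul, hs1, one_mul]
    -- parallelogram: N(ax) + ... ; N(ax) = N((ax+b) - b) ≤ 2 N(ax+b) + 2 N(b)
    have hm : (a * x).norm = a.norm * x.norm := Zsqrtd.norm_mul a x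
    have hb0 := norm_nonneg' (by omega) b
    have h4 : 4 * a.norm ≤ (a * x).norm := by rw [hm]; nlinarith
    generalize a * x = y at *
    have hN : (y + 2 * b).norm ≥ 0 := norm_nonneg' (by omega) _
    have key : (y + 2 * b).norm + y.norm  = 2 * (y + b).norm + 2 * b.norm := by
      simp only [norm_eq]; simp; ring
    by_contra hcon
    push Not at hcon
    -- N(y) = 4A+, N(b) < A, N(y+b) ≤ A : contradiction
    linarith

lemma R_sign {d : ℤ} {a b : Zsqrtd (-d)} (h : R d a b) : R d a (-b) ∧ R d (-a) b := by
  rcases h with ⟨h, rfl⟩ | ⟨c, e, x, h, rfl, rfl⟩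
  · have h' : -a = 1 ∨ -a = -1 := by rcases h with rfl | rfl <;> simp
    exact ⟨Or.inl ⟨h, by simp⟩, Or.inl ⟨h', rfl⟩⟩
  · refine ⟨Or.inr ⟨-b, e, -x, (D_sign h).2.1, by ring, rfl⟩, Or.inr ⟨b, -e, -x, (D_sign h).1, by ring, rfl⟩⟩

lemma R_mul {d : ℤ} {a b s t : Zsqrtd (-d)} (h : R d a b) (hs : s = 1 ∨ s = -1)
    (ht : t = 1 ∨ t = -1) : R d (s * a) (t * b) := by
  rcases hs with rfl | rfl <;> rcases ht with rfl | rfl <;> simp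
  · exact h
  · exact (R_sign h).1
  · exact (R_sign h).2
  · exact (R_sign (R_sign h).1).2

lemma R_add {d : ℤ} {a b : Zsqrtd (-d)} (h : R d a b) (y : Zsqrtd (-d)) : R d (a + y * b) b := by
  rcases h with ⟨h, rfl⟩ | ⟨c, e, x, h, rfl, rfl⟩
  · left; simpa using h
  · exact Or.inr ⟨b, e, x + y, h, by ring, rfl⟩

lemma R_big {d : ℤ} {c e x : Zsqrtd (-d)} (h : D d c e) (hx : 4 ≤ x.norm) : R d c (c * x + e) :=
  Or.inr ⟨c * x + e, c, 0, by simpa using D.step c e x 1 h hx (Or.inl rfl), by ring, rfl⟩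

lemma R_unit {d : ℤ} (hd : 4 ≤ d) {c e : Zsqrtd (-d)} (h : D d c e) :
    ∀ s, (s = 1 ∨ s = -1) → R d c (c * s + e) := by
  induction h with
  | base u hu =>
    intro s hs
    have hss : s * s = 1 := by rcases hs with rfl | rfl <;> simp
    refine Or.inr ⟨u * s, 0, s, D.base _ ?_, ?_, by ring⟩
    · rcases hu with rfl | rfl <;> rcases hs with rfl | rfl <;> simp
    · linear_combination (-u) * hss
  | step a b x s h hx hs ih =>
    intro t ht
    have hss : s * s = 1 := by rcases hs with rfl | rfl <;> simp
    have htt : t * t = 1 := by rcases ht with rfl | rfl <;> simp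
    have hts : t * s = 1 ∨ t * s = -1 := by
      rcases hs with rfl | rfl <;> rcases ht with rfl | rfl <;> simp
    -- f = a (x + t s) + b ; target second = t f ; first = f - t s a
    have hf : R d a (a * (x + t * s) + b) := by
      by_cases hbig : 4 ≤ (x + t * s).norm
      · exact R_big h hbig
      · rcases small hd _ (not_le.mp hbig) with h0 | h1
        · exfalso
          have : x = -(t * s) := by linear_combination h0
          rw [this] at hx
          rcases hts with h | h <;> rw [h] at hx <;> simp [Zsqrtd.norm_def] at hx
        · exact ih _ h1
    have hts' : -(t * s) = 1 ∨ -(t * s) = -1 := by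
      rcases hts with h | h <;> simp [h]
    have h2 := R_add (R_mul hf hts' ht) t
    convert h2 using 1
    · linear_combination (-(a * (x + t * s) + b)) * htt
    · linear_combination (-a * s) * htt

lemma R_swap {d : ℤ} (hd : 4 ≤ d) {a b : Zsqrtd (-d)} (h : R d a b) : R d b a := by
  rcases h with ⟨h, rfl⟩ | ⟨c, e, x, h, rfl, rfl⟩
  · exact Or.inr ⟨a, 0, 0, D.base _ h, by ring, rfl⟩
  · by_cases hx : 4 ≤ x.norm
    · exact R_big h hx
    · rcases small hd _ (not_le.mp hx) with rfl | h1
      · simp only [mul_zero, zero_add]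
        cases h with
        | base u hu => exact Or.inl ⟨hu, rfl⟩
        | step a b x s h hx hs =>
          have : R d (a * x + b) a := Or.inr ⟨a, b, x, h, rfl, rfl⟩
          simpa using R_mul this (Or.inl rfl) hs
      · exact R_unit hd h x h1

lemma unit_pm {d : ℤ} (hd : 4 ≤ d) {p r : Zsqrtd (-d)} (h : p * r = 1) : p = 1 ∨ p = -1 := by
  have hN : p.norm * r.norm = 1 := by rw [← Zsqrtd.norm_mul, h]; simp [Zsqrtd.norm_def]
  have h0 := norm_nonneg' (by omega) p
  have h1 := norm_nonneg' (by omega) r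
  have : p.norm = 1 := by
    rcases Int.mul_eq_one_iff_eq_one_or_neg_one.mp hN with h | h <;> omega
  rcases small hd p (by omega) with h0 | h0
  · rw [h0] at this; simp [Zsqrtd.norm_def] at this
  · exact h0

def S (d : ℤ) : Set (SL d) := {M : Matrix.SpecialLinearGroup (Fin 2) (Zsqrtd (-d)) |
        (M : Matrix (Fin 2) (Fin 2) (Zsqrtd (-d))) 1 0 = 0 ∨
        (M : Matrix (Fin 2) (Fin 2) (Zsqrtd (-d))) 0 1 = 0}

lemma det2 {d : ℤ} (M : SL d) : M.1 0 0 * M.1 1 1 - M.1 0 1 * M.1 1 0 = 1 := by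
  have := M.2; rwa [Matrix.det_fin_two] at this

lemma gen {d : ℤ} (hd : 4 ≤ d) (M : SL d) (hM : M ∈ S d) (a b : Zsqrtd (-d)) (h : R d a b) :
    R d (a * M.1 0 0 + b * M.1 1 0) (a * M.1 0 1 + b * M.1 1 1) := by
  have hdet := det2 M
  generalize M.1 0 0 = p at *
  have hM' : M.1 1 0 = 0 ∨ M.1 0 1 = 0 := hM
  generalize M.1 0 1 = q at *
  generalize M.1 1 0 = w at *
  generalize M.1 1 1 = r at *
  have hpr : p * r = 1 := by
    rcases hM' with h | h <;> rw [h] at hdet <;> linear_combination hdet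
  have hp := unit_pm hd hpr
  have hr := unit_pm hd (by rw [mul_comm]; exact hpr : r * p = 1)
  have h1 := R_mul h hp hr
  rcases hM' with rfl | rfl
  · have := R_swap hd (R_add (R_swap hd h1) (q * r))
    convert this using 1
    · ring
    · linear_combination (-q * a) * hpr
  · have := R_add h1 (w * p)
    convert this using 1
    · linear_combination (-w * b) * hpr
    · ring

lemma rowR {d : ℤ} (hd : 4 ≤ d) (M : SL d) (hM : M ∈ Subgroup.closure (S d)) :
    ∀ a b, R d a b ↔ R d (a * M.1 0 0 + b * M.1 1 0) (a * M.1 0 1 + b * M.1 1 1) := by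
  induction hM using Subgroup.closure_induction with
  | mem M hM =>
    intro a b
    refine ⟨gen hd M hM a b, fun h => ?_⟩
    have hdet := det2 M
    have hi : M⁻¹ ∈ S d := by
      have hM' : M.1 1 0 = 0 ∨ M.1 0 1 = 0 := hM
      change (M⁻¹).1 1 0 = 0 ∨ (M⁻¹).1 0 1 = 0
      simpa [Matrix.SpecialLinearGroup.SL2_inv_expl] using hM'
    have := gen hd _ hi _ _ h
    simp [Matrix.SpecialLinearGroup.SL2_inv_expl] at this
    convert this using 1
    · linear_combination (-a) * hdet
    · linear_combination (-b) * hdet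
  | one => intro a b; simp
  | mul M N _ _ h1 h2 =>
    intro a b
    rw [h1 a b, h2]
    have e : ∀ i j, (M * N).1 i j = M.1 i 0 * N.1 0 j + M.1 i 1 * N.1 1 j := by
      intro i j
      change (M.1 * N.1) i j = _
      rw [Matrix.mul_apply, Fin.sum_univ_two]
    rw [e, e, e, e]
    apply iff_of_eq
    congr 1 <;> ring
  | inv M _ h =>
    intro a b
    have hdet := det2 M
    rw [h (a * (M⁻¹).1 0 0 + b * (M⁻¹).1 1 0) (a * (M⁻¹).1 0 1 + b * (M⁻¹).1 1 1)]
    simp [Matrix.SpecialLinearGroup.SL2_inv_expl]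
    apply iff_of_eq
    congr 1
    · linear_combination (-a) * hdet
    · linear_combination (-b) * hdet

lemma not_top {d : ℤ} (hd : 4 ≤ d) : Subgroup.closure (S d) ≠ ⊤ := by
  intro htop
  let ω : Zsqrtd (-d) := ⟨0, 1⟩
  have hω : ω * ω = -(d : Zsqrtd (-d)) := by ext <;> simp [ω]
  let M : SL d := ⟨!![((d + 1 : ℤ) : Zsqrtd (-d)) * (1 + ω), ((2 * d + 3 : ℤ) : Zsqrtd (-d));
    ((2 * d + 1 : ℤ) : Zsqrtd (-d)), 4 * (1 - ω)], by
      rw [Matrix.det_fin_two_of]; push_cast; linear_combination (-4 * ((d : Zsqrtd (-d)) + 1)) * hω⟩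
  have hM : M ∈ Subgroup.closure (S d) := by rw [htop]; trivial
  have h := (rowR hd M hM 1 0).mp (Or.inl ⟨Or.inl rfl, rfl⟩)
  simp only [one_mul, zero_mul, add_zero] at h
  have e1 : M.1 0 0 = ((d + 1 : ℤ) : Zsqrtd (-d)) * (1 + ω) := rfl
  have e2 : M.1 0 1 = ((2 * d + 3 : ℤ) : Zsqrtd (-d)) := rfl
  rw [e1, e2] at h
  rcases h with ⟨_, h⟩ | ⟨c, e, x, h, h1, h2⟩
  · have := congrArg Zsqrtd.re h
    simp only [Zsqrtd.re_intCast, Zsqrtd.re_zero] at this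
    omega
  · have hlt := D_lt hd h
    rw [← h2] at h1 hlt
    have hre : e.re = (d + 1) - (2 * d + 3) * x.re := by
      have := congrArg Zsqrtd.re h1
      simp [ω] at this
      linarith
    have him : e.im = (d + 1) - (2 * d + 3) * x.im := by
      have := congrArg Zsqrtd.im h1
      simp [ω] at this
      linarith
    have hsq : ∀ y : ℤ, (d + 1) * (d + 1) ≤ ((d + 1) - (2 * d + 3) * y) * ((d + 1) - (2 * d + 3) * y) := by
      intro y
      rcases le_or_gt y 0 with hy | hy
      · have : d + 1 ≤ (d + 1) - (2 * d + 3) * y := by nlinarith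
        nlinarith
      · have : d + 1 ≤ -((d + 1) - (2 * d + 3) * y) := by nlinarith
        nlinarith
    rw [norm_eq, norm_eq, hre, him] at hlt
    simp only [Zsqrtd.re_intCast, Zsqrtd.im_intCast] at hlt
    have h1 := hsq x.re
    have h2 := mul_le_mul_of_nonneg_left (hsq x.im) (by omega : 0 ≤ d)
    have h3 : (2 * d + 3) * (2 * d + 3) ≤ (d + 1) * (d + 1) + d * ((d + 1) * (d + 1)) := by
      nlinarith [mul_nonneg (mul_nonneg (by omega : 0 ≤ d) (by omega : 0 ≤ d)) (by omega : 0 ≤ d - 4), mul_nonneg (by omega : 0 ≤ d) (by omega : 0 ≤ d - 4)]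
    linarith

lemma round (u n : ℤ) (hn : 0 < n) : ∃ p, -n ≤ 2 * (u - p * n) ∧ 2 * (u - p * n) ≤ n := by
  refine ⟨(2 * u + n) / (2 * n), ?_⟩
  have h1 := Int.emod_add_mul_ediv (2 * u + n) (2 * n)
  have h2 := Int.emod_nonneg (2 * u + n) (by omega : 2 * n ≠ 0)
  have h3 := Int.emod_lt_of_pos (2 * u + n) (by omega : 0 < 2 * n)
  constructor <;> nlinarith

lemma reduce {d : ℤ} (hd : 1 ≤ d) (hd3 : d ≤ 3) (a b x y : Zsqrtd (-d)) (hb : b ≠ 0)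
    (hdet : a * y - b * x = 1) : ∃ q, (a - q * b).norm < b.norm := by
  have hn := norm_pos' hd b hb
  obtain ⟨p, hp1, hp2⟩ := round (a * star b).re b.norm hn
  obtain ⟨r, hr1, hr2⟩ := round (a * star b).im b.norm hn
  refine ⟨⟨p, r⟩, ?_⟩
  set z := a - (⟨p, r⟩ : Zsqrtd (-d)) * b with hz
  have hbb : b * star b = (b.norm : Zsqrtd (-d)) := by rw [Zsqrtd.norm_eq_mul_conj]
  have hzb : z * star b = a * star b - ⟨p, r⟩ * (b.norm : Zsqrtd (-d)) := by
    rw [hz, ← hbb]; ring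
  have hs : (z * star b).re = (a * star b).re - p * b.norm := by rw [hzb]; simp
  have ht : (z * star b).im = (a * star b).im - r * b.norm := by rw [hzb]; simp
  rw [← hs] at hp1 hp2
  rw [← ht] at hr1 hr2
  have hnn : z.norm * b.norm = (z * star b).re * (z * star b).re + d * ((z * star b).im * (z * star b).im) := by
    rw [← norm_eq, Zsqrtd.norm_mul, Zsqrtd.norm_conj]
  have hdet' : z * y - b * (x - ⟨p, r⟩ * y) = 1 := by rw [hz]; linear_combination hdet
  generalize x - (⟨p, r⟩ : Zsqrtd (-d)) * y = x' at hdet'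
  clear_value z
  have hzs : z * (b.norm : Zsqrtd (-d)) = (z * star b) * b := by rw [← hbb]; ring
  generalize z * star b = w at *
  by_contra hcon
  push Not at hcon
  have hs2 : 4 * (w.re * w.re) ≤ b.norm * b.norm := by nlinarith
  have ht2 : 4 * (w.im * w.im) ≤ b.norm * b.norm := by nlinarith
  have hnz : b.norm * b.norm ≤ z.norm * b.norm := by nlinarith
  have hnp : 0 < b.norm * b.norm := by positivity
  have hd' : d = 3 := by
    by_contra hne
    have : d ≤ 2 := by omega
    have : d * (w.im * w.im) ≤ 2 * (w.im * w.im) := by nlinarith [mul_self_nonneg w.im]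
    linarith
  subst hd'
  have es : 4 * (w.re * w.re) = b.norm * b.norm := by linarith
  have et : 4 * (w.im * w.im) = b.norm * b.norm := by linarith
  have es' : 2 * w.re = b.norm ∨ 2 * w.re = - b.norm :=
    mul_self_eq_mul_self_iff.mp (by linarith)
  have et' : 2 * w.im = b.norm ∨ 2 * w.im = - b.norm :=
    mul_self_eq_mul_self_iff.mp (by linarith)
  have c1 := congrArg Zsqrtd.re hzs
  have c2 := congrArg Zsqrtd.im hzs
  have c3 := congrArg Zsqrtd.re hdet'
  have c4 := congrArg Zsqrtd.im hdet'
  simp at c1 c2 c3 c4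
  generalize b.norm = n at *
  have par : ∃ i j k l : ℤ, (i = z.re - z.im ∧ i = 2 * k) ∧ (j = b.re - b.im ∧ j = 2 * l) := by
    have fin : ∀ ε δ : ℤ, 2 * w.re = ε * n → 2 * w.im = δ * n →
        2 * z.re = ε * b.re - 3 * δ * b.im ∧ 2 * z.im = ε * b.im + δ * b.re := by
      intro ε δ h1 h2
      constructor
      · apply mul_right_cancel₀ hn.ne'
        linear_combination 2 * c1 + b.re * h1 - 3 * b.im * h2
      · apply mul_right_cancel₀ hn.ne'
        linear_combination 2 * c2 + b.im * h1 + b.re * h2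
    refine ⟨_, _, (z.re - z.im) / 2, (b.re - b.im) / 2, ⟨rfl, ?_⟩, ⟨rfl, ?_⟩⟩ <;>
    rcases es' with es' | es' <;> rcases et' with et' | et'
    all_goals first
      | (have := fin 1 1 (by linarith) (by linarith); omega)
      | (have := fin 1 (-1) (by linarith) (by linarith); omega)
      | (have := fin (-1) 1 (by linarith) (by linarith); omega)
      | (have := fin (-1) (-1) (by linarith) (by linarith); omega)
  obtain ⟨i, j, k, l, ⟨h1, h2⟩, ⟨h3, h4⟩⟩ := par
  have hzr : z.re = z.im + 2 * k := by omega
  have hbr : b.re = b.im + 2 * l := by omega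
  rw [hzr, hbr] at c3 c4
  have : 2 * ((z.im + k) * y.re + (k - z.im) * y.im - ((b.im + l) * x'.re + (l - b.im) * x'.im)) = 1 := by
    linear_combination c3 + c4
  omega

def Lm {d : ℤ} (t : Zsqrtd (-d)) : SL d := ⟨!![1, 0; t, 1], by simp [Matrix.det_fin_two_of]⟩

def Um {d : ℤ} (t : Zsqrtd (-d)) : SL d := ⟨!![1, t; 0, 1], by simp [Matrix.det_fin_two_of]⟩

lemma top {d : ℤ} (hd : 1 ≤ d) (hd3 : d ≤ 3) (n : ℕ) :
    ∀ M : SL d, (M.1 0 1).norm.toNat = n → M ∈ Subgroup.closure (S d) := by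
  induction n using Nat.strong_induction_on with
  | _ n ih =>
    intro M hMn
    by_cases hb : M.1 0 1 = 0
    · exact Subgroup.subset_closure (Or.inr hb)
    have hdet := det2 M
    obtain ⟨q, hq⟩ := reduce hd hd3 _ _ _ _ hb hdet
    have hL : ∀ t : Zsqrtd (-d), Lm t ∈ Subgroup.closure (S d) :=
      fun t => Subgroup.subset_closure (Or.inr rfl)
    have hU : ∀ t : Zsqrtd (-d), Um t ∈ Subgroup.closure (S d) :=
      fun t => Subgroup.subset_closure (Or.inl rfl)
    have hg := mul_mem (mul_mem (hL (-q)) (hU 1)) (mul_mem (hL (-1)) (hU 1))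
    have hgv : (Lm (-q) * Um 1 * (Lm (-1) * Um 1)).1 = !![0, 1; -1, -q] := by
      change (!![1, 0; -q, 1] * !![1, 1; 0, 1]) * (!![1, 0; -1, 1] * !![1, 1; 0, 1]) = _
      simp [Matrix.mul_fin_two]
    generalize Lm (-q) * Um 1 * (Lm (-1) * Um 1) = g at hg hgv
    rw [← Subgroup.mul_mem_cancel_right _ hg]
    have e : (M * g).1 0 1 = M.1 0 0 - q * M.1 0 1 := by
      change (M.1 * g.1) 0 1 = _
      rw [hgv, Matrix.mul_apply, Fin.sum_univ_two]
      simp; ring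
    refine ih _ ?_ (M * g) rfl
    rw [e]
    have := norm_nonneg' hd (M.1 0 0 - q * M.1 0 1)
    omega

end ESub



/-- For every integer `d ≥ 1`, the subgroup of `SL(2, ℤ[√−d])` generated
by the upper and lower triangular matrices is the whole group iff `d ≤ 3`. -/
theorem elementary_subgroup_eq_top_iff (d : ℤ) (hd : 1 ≤ d) :
    (Subgroup.closure
      {M : Matrix.SpecialLinearGroup (Fin 2) (Zsqrtd (-d)) |
        (M : Matrix (Fin 2) (Fin 2) (Zsqrtd (-d))) 1 0 = 0 ∨
        (M : Matrix (Fin 2) (Fin 2) (Zsqrtd (-d))) 0 1 = 0} = ⊤) ↔ d ≤ 3 := by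
  change Subgroup.closure (ESub.S d) = ⊤ ↔ d ≤ 3
  constructor
  · intro h
    by_contra hd3
    exact ESub.not_top (by omega) h
  · intro hd3
    rw [eq_top_iff]
    intro M _
    exact ESub.top hd hd3 _ M rfl
end

section
/- Let K be an imaginary quadratic number field (a number field of degree 2 over ℚ admitting no real embedding) with ring of integers 𝒪_K. If the absolute value of the discriminant of K is greater than 11, then the subgroup of SL(2, 𝒪_K) generated by the upper triangular and lower triangular matrices has infinite index in SL(2, 𝒪_K) and is not a normal subgroup of SL(2, 𝒪_K). -/
namespace ElemSL

inductive Core {R : Type*} [CommRing R] (A B : R) : R → R → Prop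
  | base : Core A B A B
  | one (a : R) : Core A B (a * A - B) A
  | step (a p q : R) : Core A B p q → a ≠ 0 → a ≠ 1 → a ≠ -1 → Core A B (a * p - q) p

/-- pairs reachable by one more step. -/
def Good {R : Type*} [CommRing R] (A B x y : R) : Prop :=
  ∃ p q c, Core A B p q ∧ ((x = c * p - q ∧ y = p) ∨ (x = -(c * p - q) ∧ y = -p))

section ring
variable {R : Type*} [CommRing R] {A B : R}

lemma Good.neg {x y : R} (h : Good A B x y) : Good A B (-x) (-y) := by
  obtain ⟨p, q, c, h, h' | h'⟩ := h
  · exact ⟨p, q, c, h, Or.inr ⟨by rw [h'.1], by rw [h'.2]⟩⟩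
  · exact ⟨p, q, c, h, Or.inl ⟨by rw [h'.1, neg_neg], by rw [h'.2, neg_neg]⟩⟩

lemma Core.next {p q : R} (h : Core A B p q) (c : R) : Good A B (c * p - q) p :=
  ⟨p, q, c, h, Or.inl ⟨rfl, rfl⟩⟩

lemma Core.close_aux {r s a : R} (hr : Core A B r s)
    (ih : ∀ c d : R, Good A B (d * (c * r - s) - r) (c * r - s)) (c d : R)
    (hc : c = 0 ∨ c = 1 ∨ c = -1) :
    Good A B (d * (c * (a * r - s) - r) - (a * r - s)) (c * (a * r - s) - r) := by
  rcases hc with rfl | rfl | rfl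
  · have := (hr.next (d + a)).neg
    convert this using 1 <;> ring
  · have := ih (a - 1) (d - 1)
    convert this using 1 <;> ring
  · have := (ih (a + 1) (d + 1)).neg
    convert this using 1 <;> ring

lemma Core.close {p q : R} (h : Core A B p q) :
    ∀ c d : R, Good A B (d * (c * p - q) - p) (c * p - q) := by
  induction h with
  | base => intro c d; exact (Core.one c).next d
  | one a =>
    intro c d
    by_cases hc : c = 0 ∨ c = 1 ∨ c = -1
    · exact Core.close_aux Core.base (fun c d => (Core.one c).next d) c d hc
    · push Not at hc
      exact (Core.step c _ _ (Core.one a) hc.1 hc.2.1 hc.2.2).next d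
  | step a p q h h0 h1 h2 ih =>
    intro c d
    by_cases hc : c = 0 ∨ c = 1 ∨ c = -1
    · exact Core.close_aux h ih c d hc
    · push Not at hc
      exact (Core.step c _ _ (Core.step a p q h h0 h1 h2) hc.1 hc.2.1 hc.2.2).next d

lemma Good.act {x y : R} (h : Good A B x y) (d : R) : Good A B (d * x - y) x := by
  obtain ⟨p, q, c, h, ⟨rfl, rfl⟩ | ⟨rfl, rfl⟩⟩ := h
  · exact h.close c d
  · have := (h.close c d).neg
    convert this using 1; ring

lemma Good.init : Good A B A B := by
  have := ((Core.base (A := A) (B := B)).close 0 0).act 0 |>.act 0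
  convert this using 1 <;> ring

lemma Good.upper {x y : R} (h : Good A B x y) (b : R) : Good A B x (b * x + y) := by
  have := ((h.act (-b)).act 0).neg
  convert this using 1 <;> ring

lemma Good.lower {x y : R} (h : Good A B x y) (b : R) : Good A B (x + b * y) y := by
  have := ((h.act 0).act b).neg
  convert this using 1 <;> ring

open Matrix in
lemma Good.gen (hu : ∀ u v : R, u * v = 1 → (u = 1 ∧ v = 1) ∨ (u = -1 ∧ v = -1))
    (M : SpecialLinearGroup (Fin 2) R) (hM : M.1 1 0 = 0 ∨ M.1 0 1 = 0)
    {x y : R} (h : Good A B x y) :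
    Good A B (x * M.1 0 0 + y * M.1 1 0) (x * M.1 0 1 + y * M.1 1 1) := by
  have hd := M.2
  rw [Matrix.det_fin_two] at hd
  rcases hM with h0 | h0
  · rw [h0] at hd ⊢
    rcases hu (M.1 0 0) (M.1 1 1) (by linear_combination hd) with ⟨h1, h2⟩ | ⟨h1, h2⟩
    · rw [h1, h2]
      convert h.upper (M.1 0 1) using 1 <;> ring
    · rw [h1, h2]
      convert (h.upper (-M.1 0 1)).neg using 1 <;> ring
  · rw [h0] at hd ⊢
    rcases hu (M.1 0 0) (M.1 1 1) (by linear_combination hd) with ⟨h1, h2⟩ | ⟨h1, h2⟩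
    · rw [h1, h2]
      convert h.lower (M.1 1 0) using 1 <;> ring
    · rw [h1, h2]
      convert (h.lower (-M.1 1 0)).neg using 1 <;> ring

/-- the elementary subgroup. -/
abbrev E (R : Type*) [CommRing R] : Subgroup (Matrix.SpecialLinearGroup (Fin 2) R) :=
  Subgroup.closure {M | (M : Matrix (Fin 2) (Fin 2) R) 1 0 = 0 ∨
    (M : Matrix (Fin 2) (Fin 2) R) 0 1 = 0}

lemma mul_ent (M N : Matrix.SpecialLinearGroup (Fin 2) R) (i j : Fin 2) :
    (M * N).1 i j = M.1 i 0 * N.1 0 j + M.1 i 1 * N.1 1 j := by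
  change (M.1 * N.1) i j = _
  rw [Matrix.mul_apply, Fin.sum_univ_two]

lemma inv_ent (M : Matrix.SpecialLinearGroup (Fin 2) R) :
    M⁻¹.1 0 0 = M.1 1 1 ∧ M⁻¹.1 0 1 = -M.1 0 1 ∧ M⁻¹.1 1 0 = -M.1 1 0 ∧ M⁻¹.1 1 1 = M.1 0 0 := by
  rw [Matrix.SpecialLinearGroup.SL2_inv_expl]
  exact ⟨rfl, rfl, rfl, rfl⟩

lemma Good.orbit (hu : ∀ u v : R, u * v = 1 → (u = 1 ∧ v = 1) ∨ (u = -1 ∧ v = -1))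
    (e : Matrix.SpecialLinearGroup (Fin 2) R) (he : e ∈ E R) :
    ∀ x y : R, Good A B x y →
    Good A B (x * e.1 0 0 + y * e.1 1 0) (x * e.1 0 1 + y * e.1 1 1) := by
  suffices H : (∀ x y : R, Good A B x y →
    Good A B (x * e.1 0 0 + y * e.1 1 0) (x * e.1 0 1 + y * e.1 1 1)) ∧
    (∀ x y : R, Good A B x y →
    Good A B (x * e⁻¹.1 0 0 + y * e⁻¹.1 1 0) (x * e⁻¹.1 0 1 + y * e⁻¹.1 1 1)) from H.1
  induction he using Subgroup.closure_induction with
  | mem M hM =>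
    refine ⟨fun _ _ h => h.gen hu M hM, fun _ _ h => h.gen hu M⁻¹ ?_⟩
    obtain ⟨-, h1, h2, -⟩ := inv_ent M
    rw [h1, h2, neg_eq_zero, neg_eq_zero]
    exact hM
  | one =>
    have : ∀ x y : R, Good A B x y →
      Good A B (x * (1 : Matrix (Fin 2) (Fin 2) R) 0 0 + y * (1 : Matrix (Fin 2) (Fin 2) R) 1 0)
        (x * (1 : Matrix (Fin 2) (Fin 2) R) 0 1 + y * (1 : Matrix (Fin 2) (Fin 2) R) 1 1) := by
      intro x y h
      simpa using h
    refine ⟨this, ?_⟩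
    rw [inv_one]
    exact this
  | inv M _ ih => exact ⟨ih.2, by rw [inv_inv]; exact ih.1⟩
  | mul M N _ _ h1 h2 =>
    constructor
    · intro x y h
      have := h2.1 _ _ (h1.1 _ _ h)
      simp only [mul_ent]
      convert this using 1 <;> ring
    · intro x y h
      have := h1.2 _ _ (h2.2 _ _ h)
      rw [mul_inv_rev]
      simp only [mul_ent]
      convert this using 1 <;> ring

end ring

section norm
variable {R : Type*} [CommRing R] (φ : R →+* ℂ)

lemma norm_step (h4 : ∀ x : R, x = 0 ∨ x = 1 ∨ x = -1 ∨ 2 ≤ ‖φ x‖) {a p q : R}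
    (h0 : a ≠ 0) (h1 : a ≠ 1) (h2 : a ≠ -1) (hpq : ‖φ q‖ ≤ ‖φ p‖) :
    ‖φ p‖ ≤ ‖φ (a * p - q)‖ := by
  have ha : 2 ≤ ‖φ a‖ := by
    rcases h4 a with h | h | h | h
    · exact absurd h h0
    · exact absurd h h1
    · exact absurd h h2
    · exact h
  rw [map_sub, map_mul]
  have := norm_sub_norm_le (φ a * φ p) (φ q)
  rw [norm_mul] at this
  nlinarith [norm_nonneg (φ p)]

lemma Core.bound (h4 : ∀ x : R, x = 0 ∨ x = 1 ∨ x = -1 ∨ 2 ≤ ‖φ x‖)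
    (hint : ∀ x : R, ∃ n : ℤ, ‖φ x‖ ^ 2 = n) {A B : R}
    (hBA : ‖φ B‖ ≤ ‖φ A‖) (hAB : ‖φ A‖ ^ 2 ≤ ‖φ B‖ ^ 2 + 1)
    (hm : ‖φ A‖ ≤ ‖φ (A - B)‖) (hp : ‖φ A‖ ≤ ‖φ (A + B)‖) {p q : R} (h : Core A B p q) :
    (‖φ q‖ ≤ ‖φ p‖ ∧ ‖φ B‖ ≤ ‖φ p‖) ∨ (p = -B ∧ q = A) := by
  induction h with
  | base => exact Or.inl ⟨hBA, hBA⟩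
  | one a =>
    by_cases h0 : a = 0
    · right; simp [h0]
    left
    suffices h : ‖φ A‖ ≤ ‖φ (a * A - B)‖ from ⟨h, hBA.trans h⟩
    by_cases h1 : a = 1
    · simpa [h1] using hm
    by_cases h2 : a = -1
    · have : a * A - B = -(A + B) := by rw [h2]; ring
      rw [this, map_neg, norm_neg]; exact hp
    exact norm_step φ h4 h0 h1 h2 hBA
  | step a p q h h0 h1 h2 ih =>
    left
    rcases ih with ⟨h3, h5⟩ | ⟨rfl, rfl⟩
    · have := norm_step φ h4 h0 h1 h2 h3
      exact ⟨this, h5.trans this⟩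
    · suffices h : ‖φ B‖ ≤ ‖φ (a * -B - q)‖ from ⟨by simpa using h, h⟩
      by_contra! hlt
      obtain ⟨n, hn⟩ := hint (a * -B - q)
      obtain ⟨k, hk⟩ := hint B
      have h6 : ‖φ (a * -B - q)‖ ^ 2 < ‖φ B‖ ^ 2 := by gcongr
      have h7 : ‖φ (a * -B - q)‖ ^ 2 ≤ ‖φ B‖ ^ 2 - 1 := by
        rw [hn, hk] at h6 ⊢
        have : n < k := by exact_mod_cast h6
        have : n ≤ k - 1 := by omega
        exact_mod_cast this
      have ha : 2 ≤ ‖φ a‖ := by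
        rcases h4 a with h | h | h | h
        · exact absurd h h0
        · exact absurd h h1
        · exact absurd h h2
        · exact h
      have h8 := norm_sub_norm_le (φ a * φ (-B)) (φ q)
      rw [norm_mul, map_neg, norm_neg] at h8
      have h9 : φ a * -φ B - φ q = φ (a * -B - q) := by simp
      rw [h9] at h8
      set w := ‖φ (a * -B - q)‖
      have hB := norm_nonneg (φ B)
      have hw : 0 ≤ w := norm_nonneg _
      have h10 : 2 * ‖φ B‖ ≤ w + ‖φ q‖ := by nlinarith
      have h11 : 0 < (‖φ q‖ - w) ^ 2 := by
        have : 0 < ‖φ q‖ - w := by linarith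
        positivity
      nlinarith

lemma units_of (h4 : ∀ x : R, x = 0 ∨ x = 1 ∨ x = -1 ∨ 2 ≤ ‖φ x‖) (u v : R) (h : u * v = 1) :
    (u = 1 ∧ v = 1) ∨ (u = -1 ∧ v = -1) := by
  have h1 : ‖φ u‖ * ‖φ v‖ = 1 := by rw [← norm_mul, ← map_mul, h]; simp
  have hne : (0 : R) ≠ 1 := fun h => by simpa using congrArg φ h
  rcases h4 u with rfl | rfl | rfl | hu
  · simp [hne] at h
  · left; simpa using h
  · right; exact ⟨rfl, by linear_combination -h⟩
  · rcases h4 v with rfl | rfl | rfl | hv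
    · simp [hne] at h
    · simp at h1; linarith
    · simp at h1; linarith
    · nlinarith

lemma orbit_bound (h4 : ∀ x : R, x = 0 ∨ x = 1 ∨ x = -1 ∨ 2 ≤ ‖φ x‖)
    (hint : ∀ x : R, ∃ n : ℤ, ‖φ x‖ ^ 2 = n) {A B : R}
    (hBA : ‖φ B‖ ≤ ‖φ A‖) (hAB : ‖φ A‖ ^ 2 ≤ ‖φ B‖ ^ 2 + 1)
    (hm : ‖φ A‖ ≤ ‖φ (A - B)‖) (hp : ‖φ A‖ ≤ ‖φ (A + B)‖)
    (e : Matrix.SpecialLinearGroup (Fin 2) R) (he : e ∈ E R) :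
    ‖φ B‖ ≤ ‖φ (A * e.1 0 1 + B * e.1 1 1)‖ := by
  obtain ⟨p, q, c, hc, h⟩ := Good.orbit (units_of φ h4) e he _ _ (Good.init (A := A) (B := B))
  have h1 : ‖φ B‖ ≤ ‖φ p‖ := by
    rcases hc.bound φ h4 hint hBA hAB hm hp with h | h
    · exact h.2
    · simp [h.1]
  rcases h with h | h
  · rwa [h.2]
  · rwa [h.2, map_neg, norm_neg]

/-- the Pell matrix. -/
def pm (s : R) (m a b : ℤ) (hs : s ^ 2 = -(m : R)) (hab : a ^ 2 - m * b ^ 2 = 1) :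
    Matrix.SpecialLinearGroup (Fin 2) R :=
  ⟨!![(a + b * s : R), a - b * s; m * b ^ 2 * (a - b * s), (a - b * s) - m * b ^ 2 * (a + b * s)], by
    have h : (a : R) ^ 2 - m * b ^ 2 = 1 := by exact_mod_cast congrArg (Int.cast : ℤ → R) hab
    rw [Matrix.det_fin_two_of]
    linear_combination (1 - 2 * (m:R) * b ^ 2) * h - (b ^ 2 + 2 * (m:R) * b ^ 4) * hs⟩

lemma phi_s {s : R} {m : ℤ} (hm : 0 < m) (hs : s ^ 2 = -(m : R)) :
    ∃ y : ℝ, φ s = y * Complex.I ∧ y ^ 2 = m := by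
  have h := congrArg φ hs
  have hm' : (0 : ℝ) < m := by exact_mod_cast hm
  simp only [map_pow, map_neg, map_intCast] at h
  have h1 := congrArg Complex.re h
  have h2 := congrArg Complex.im h
  simp [pow_two] at h1 h2
  have h3 : (φ s).re = 0 := by
    by_contra h0
    have : (φ s).im = 0 := by
      have : (φ s).re * (φ s).im = 0 := by linarith
      exact (mul_eq_zero.mp this).resolve_left h0
    rw [this] at h1
    nlinarith
  refine ⟨(φ s).im, ?_, ?_⟩
  · apply Complex.ext <;> simp [h3]
  · rw [h3] at h1; linarith

lemma le_of_sq {z w : ℂ} (h : z.re ^ 2 + z.im ^ 2 ≤ w.re ^ 2 + w.im ^ 2) : ‖z‖ ≤ ‖w‖ := by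
  rw [← abs_of_nonneg (norm_nonneg z), ← abs_of_nonneg (norm_nonneg w), ← sq_le_sq,
    Complex.sq_norm, Complex.sq_norm, Complex.normSq_apply, Complex.normSq_apply]
  linarith

lemma pell_le (h4 : ∀ x : R, x = 0 ∨ x = 1 ∨ x = -1 ∨ 2 ≤ ‖φ x‖)
    (hint : ∀ x : R, ∃ n : ℤ, ‖φ x‖ ^ 2 = n) {s : R} {m a b c d : ℤ} (hm : 0 < m)
    (hs : s ^ 2 = -(m : R)) (hab : a ^ 2 - m * b ^ 2 = 1) (hcd : c ^ 2 - m * d ^ 2 = 1)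
    (hb : b ≠ 0)
    (h : (pm s m a b hs hab)⁻¹ * pm s m c d hs hcd ∈ E R) : b ^ 2 ≤ d ^ 2 := by
  obtain ⟨y, hy, hym⟩ := phi_s φ hm hs
  have hm1 : (1 : ℝ) ≤ m := by exact_mod_cast hm
  have hb1 : (1 : ℝ) ≤ (b : ℝ) ^ 2 := by
    have : 1 ≤ b ^ 2 := by have := sq_pos_of_ne_zero hb; omega
    exact_mod_cast this
  have hab' : (a : ℝ) ^ 2 - m * b ^ 2 = 1 := by exact_mod_cast hab
  have hcd' : (c : ℝ) ^ 2 - m * d ^ 2 = 1 := by exact_mod_cast hcd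
  have key := orbit_bound φ h4 hint (A := a + b * s) (B := a - b * s)
    (le_of_sq (by simp [hy])) 
    (by simp only [Complex.sq_norm, Complex.normSq_apply]; simp [hy]) 
    (le_of_sq (by simp [hy]; nlinarith)) (le_of_sq (by simp [hy]; nlinarith)) _ h
  have h5 : (pm s m a b hs hab) * ((pm s m a b hs hab)⁻¹ * pm s m c d hs hcd) = pm s m c d hs hcd := by
    group
  have h6 := congrArg (fun g => g.1 0 1) h5
  simp only [Matrix.SpecialLinearGroup.coe_mul (pm s m a b hs hab), Matrix.mul_apply (M := (pm s m a b hs hab).1), Fin.sum_univ_two] at h6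
  have e1 : (pm s m a b hs hab).1 0 0 = a + b * s := rfl
  have e2 : (pm s m a b hs hab).1 0 1 = a - b * s := rfl
  have e3 : (pm s m c d hs hcd).1 0 1 = c - d * s := rfl
  rw [e1, e2, e3] at h6
  rw [h6] at key
  have key2 := pow_le_pow_left₀ (norm_nonneg _) key 2
  simp only [Complex.sq_norm, Complex.normSq_apply] at key2
  simp [hy] at key2
  have : (b : ℝ) ^ 2 ≤ (d : ℝ) ^ 2 := by nlinarith
  exact_mod_cast this

lemma index_zero (h4 : ∀ x : R, x = 0 ∨ x = 1 ∨ x = -1 ∨ 2 ≤ ‖φ x‖)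
    (hint : ∀ x : R, ∃ n : ℤ, ‖φ x‖ ^ 2 = n) {s : R} {m : ℤ} (hm : 0 < m)
    (hsq : ¬ IsSquare m) (hs : s ^ 2 = -(m : R)) : (E R).index = 0 := by
  obtain ⟨a, ha⟩ := Pell.IsFundamental.exists_of_not_isSquare hm hsq
  have hne : ∀ n : ℕ, (a ^ (n+1)).y ≠ 0 := fun n => (ha.y_strictMono.injective.ne
    (show ((n:ℤ)+1) ≠ 0 by omega)) |> fun h => by simpa using mod_cast h
  have hinj : ∀ k l : ℕ, (a ^ (k+1)).y ^ 2 = (a ^ (l+1)).y ^ 2 → k = l := by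
    have hpos : ∀ n : ℕ, 0 < (a ^ (n+1)).y := fun n => by
      have := ha.y_strictMono (show (0:ℤ) < (n:ℤ)+1 by omega)
      have h2 : (a ^ ((n : ℤ) + 1)).y = (a ^ (n+1)).y := by norm_cast
      simp only [zpow_zero, Pell.Solution₁.y_one, h2] at this
      exact this
    intro k l h
    have h1 : (a ^ (k+1)).y = (a ^ (l+1)).y := by
      have := hpos k; have := hpos l
      exact (pow_left_inj₀ (by omega) (by omega) two_ne_zero).mp h
    have := ha.y_strictMono.injective (a₁ := (k:ℤ)+1) (a₂ := (l:ℤ)+1) (by exact_mod_cast h1)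
    omega
  let f : ℕ → Matrix.SpecialLinearGroup (Fin 2) R ⧸ E R := fun n =>
    QuotientGroup.mk (pm s m (a ^ (n+1)).x (a ^ (n+1)).y hs (a ^ (n+1)).prop)
  have hf : Function.Injective f := by
    intro k l h
    apply hinj
    apply le_antisymm
    · exact pell_le φ h4 hint hm hs _ _ (hne k) (QuotientGroup.eq.mp h)
    · exact pell_le φ h4 hint hm hs _ _ (hne l) (QuotientGroup.eq.mp h.symm)
  have : Infinite (Matrix.SpecialLinearGroup (Fin 2) R ⧸ E R) := Infinite.of_injective f hf
  exact Subgroup.index_eq_zero_iff_infinite.mpr this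

lemma not_normal (h4 : ∀ x : R, x = 0 ∨ x = 1 ∨ x = -1 ∨ 2 ≤ ‖φ x‖)
    (hint : ∀ x : R, ∃ n : ℤ, ‖φ x‖ ^ 2 = n) {s : R} {m : ℤ} (hm : 0 < m)
    (hsq : ¬ IsSquare m) (hs : s ^ 2 = -(m : R)) : ¬ (E R).Normal := by
  intro hN
  obtain ⟨a, b, hab, hb⟩ := Pell.exists_of_not_isSquare hm hsq
  have hsq1 : m ≠ 1 := by rintro rfl; exact hsq ⟨1, rfl⟩
  obtain ⟨y, hy, hym⟩ := phi_s φ hm hs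
  have hm1 : (2 : ℝ) ≤ m := by exact_mod_cast (by omega : 2 ≤ m)
  have hb1 : (1 : ℝ) ≤ (b : ℝ) ^ 2 := by
    have : 1 ≤ b ^ 2 := by have := sq_pos_of_ne_zero hb; omega
    exact_mod_cast this
  have hab' : (a : ℝ) ^ 2 - m * b ^ 2 = 1 := by exact_mod_cast hab
  have habR : (a : R) ^ 2 - m * b ^ 2 = 1 := by exact_mod_cast congrArg (Int.cast : ℤ → R) hab
  let g := (pm s m a b hs hab).transpose
  let t : Matrix.SpecialLinearGroup (Fin 2) R := ⟨!![1, s; 0, 1], by simp⟩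
  have ht : t ∈ E R := Subgroup.subset_closure (Or.inl rfl)
  have hc := (E R).inv_mem (hN.conj_mem t ht g)
  have g00 : g.1 0 0 = a + b * s := rfl
  have g10 : g.1 1 0 = a - b * s := rfl
  have g01 : g.1 0 1 = m * b ^ 2 * (a - b * s) := rfl
  have g11 : g.1 1 1 = (a - b * s) - m * b ^ 2 * (a + b * s) := rfl
  have t00 : t.1 0 0 = 1 := rfl
  have t10 : t.1 1 0 = 0 := rfl
  have t01 : t.1 0 1 = s := rfl
  have t11 : t.1 1 1 = 1 := rfl
  have hdet := g.2
  rw [Matrix.det_fin_two] at hdet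
  obtain ⟨i00, i01, i10, i11⟩ := inv_ent g
  have e00 : (g * t * g⁻¹).1 0 0 = 1 - s * (1 + 2 * m * b ^ 2) := by
    rw [mul_ent, mul_ent, mul_ent, i00, i10, t00, t01, t10, t11]
    have : (g.1 0 0) * (g.1 1 0) = 1 + 2 * m * b ^ 2 := by
      rw [g00, g10]; linear_combination habR - b ^ 2 * hs
    linear_combination hdet - s * this
  have e01 : (g * t * g⁻¹).1 0 1 = s - 2 * a * b * m := by
    rw [mul_ent, mul_ent, mul_ent, i01, i11, t00, t01, t10, t11]
    have : (g.1 0 0) * (g.1 0 0) = 1 + 2 * a * b * s := by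
      rw [g00]; linear_combination habR + b ^ 2 * hs
    linear_combination s * this + 2 * a * b * hs
  set h := g * t * g⁻¹
  have h1 : h * h⁻¹ = 1 := by group
  have h2 : (h * h⁻¹).1 0 1 = 0 := by rw [h1]; rfl
  rw [mul_ent, e00, e01] at h2
  have nN : (4 : ℝ) ≤ 1 + 2 * m * b ^ 2 := by nlinarith
  have nB : (2 * (a : ℝ) * b * m) ^ 2 + y ^ 2 = m * (1 + 2 * m * b ^ 2) ^ 2 := by
    rw [hym]; linear_combination 4 * (b : ℝ) ^ 2 * m ^ 2 * hab'
  have nab : |2 * (a : ℝ) * b| ≤ 1 + 2 * m * b ^ 2 := by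
    rw [abs_le]; constructor <;> nlinarith [sq_nonneg ((a : ℝ) + b), sq_nonneg ((a : ℝ) - b)]
  obtain ⟨nab1, nab2⟩ := abs_le.mp nab
  set N : ℝ := 1 + 2 * m * b ^ 2 with hNdef
  have p2 : φ 2 = 2 := map_ofNat φ 2
  have rA : (φ (1 - s * (1 + 2 * m * b ^ 2))).re = 1 := by simp [p2, hy, pow_two]
  have iA : (φ (1 - s * (1 + 2 * m * b ^ 2))).im = - y * N := by simp [p2, hy, pow_two, hNdef]
  have rB : (φ (s - 2 * a * b * m)).re = - (2 * a * b * m) := by simp [p2, hy]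
  have iB : (φ (s - 2 * a * b * m)).im = y := by simp [p2, hy]
  have nA : 1 ^ 2 + (- y * N) ^ 2 = (m : ℝ) * N ^ 2 + 1 := by rw [← hym]; ring
  have nN2 : 4 * N ≤ N ^ 2 := by nlinarith
  have key := orbit_bound φ h4 hint (A := 1 - s * (1 + 2 * m * b ^ 2)) (B := s - 2 * a * b * m)
    (le_of_sq (by rw [rA, iA, rB, iB, nA, neg_sq, nB]; linarith))
    (by
      rw [Complex.sq_norm, Complex.sq_norm, Complex.normSq_apply, Complex.normSq_apply,
        rA, iA, rB, iB]; linarith)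
    (le_of_sq (by
      rw [map_sub _ (1 - s * (1 + 2 * m * b ^ 2)), Complex.sub_re, Complex.sub_im,
        rA, iA, rB, iB]
      have : 0 ≤ (m : ℝ) * (N ^ 2 + 2 * (2 * a * b) + 2 * N) := by
        apply mul_nonneg <;> linarith
      linear_combination this - nB - 2 * N * hym))
    (le_of_sq (by
      rw [map_add _ (1 - s * (1 + 2 * m * b ^ 2)), Complex.add_re, Complex.add_im,
        rA, iA, rB, iB]
      have : 0 ≤ (m : ℝ) * (N ^ 2 - 2 * (2 * a * b) - 2 * N) := by
        apply mul_nonneg <;> linarith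
      linear_combination this - nB + 2 * N * hym)) _ hc
  rw [h2, map_zero, norm_zero] at key
  have key2 := pow_le_pow_left₀ (norm_nonneg _) key 2
  rw [Complex.sq_norm, Complex.normSq_apply, rB, iB] at key2
  nlinarith
end norm
open NumberField
section nf
variable {K : Type*} [Field K] [NumberField K]

lemma real_int (hdeg : Module.finrank ℚ K = 2) (himag : IsEmpty (K →+* ℝ)) (φ : K →+* ℂ)
    (x : 𝓞 K) (hx : (φ x).im = 0) : ∃ k : ℤ, x = k := by
  let F : IntermediateField ℚ K := IntermediateField.comap (φ.toRatAlgHom)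
    (IsScalarTower.toAlgHom ℚ ℝ ℂ).fieldRange
  have hF : ∀ z : K, z ∈ F ↔ (φ z).im = 0 := by
    intro z
    change φ z ∈ (IsScalarTower.toAlgHom ℚ ℝ ℂ).fieldRange ↔ _
    rw [AlgHom.mem_fieldRange]
    constructor
    · rintro ⟨r, hr⟩
      rw [← hr]; simp
    · intro h
      exact ⟨(φ z).re, by apply Complex.ext <;> simp [h]⟩
  have := IntermediateField.isSimpleOrder_of_finrank_prime ℚ K (by rw [hdeg]; exact Nat.prime_two)
  rcases this.eq_bot_or_eq_top F with h | h
  · have hxF : (x : K) ∈ F := (hF x).2 hx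
    rw [h, IntermediateField.mem_bot] at hxF
    obtain ⟨q, hq⟩ := hxF
    have : IsIntegral ℤ q := by
      rw [← isIntegral_algebraMap_iff (algebraMap ℚ K).injective, hq]
      exact x.isIntegral_coe
    obtain ⟨k, hk⟩ := IsIntegrallyClosed.isIntegral_iff.mp this
    refine ⟨k, RingOfIntegers.ext ?_⟩
    rw [← hq, ← hk]
    simp
  · exfalso
    have hr : ∀ z : K, (φ z).im = 0 := fun z => (hF z).1 (by rw [h]; trivial)
    refine himag.false
      { toFun := fun z => (φ z).re, map_one' := by simp, map_zero' := by simp,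
        map_add' := by simp, map_mul' := fun a b => by simp [hr] }

lemma quad (hdeg : Module.finrank ℚ K = 2) (x : 𝓞 K) : ∃ t n c : ℤ,
    x ^ 2 - t * x + n = 0 ∧ t ^ 2 - 4 * n = c * discr K := by
  let b : Module.Basis (Fin 2) ℤ (𝓞 K) :=
    (Module.finBasisOfFinrankEq ℤ (𝓞 K) (by rw [RingOfIntegers.rank, hdeg]))
  let M := Algebra.leftMulMatrix b x
  have hx2 : x ^ 2 - (M.trace : ℤ) * x + (M.det : ℤ) = 0 := by
    apply Algebra.leftMulMatrix_injective b
    have h1 : Algebra.leftMulMatrix b x = M := rfl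
    have h2 : ∀ k : ℤ, Algebra.leftMulMatrix b (k : 𝓞 K) = k • 1 := by
      intro k
      rw [← zsmul_one k, map_zsmul, map_one]
    rw [map_add, map_sub, map_mul, map_pow, h1, h2, h2, map_zero, Matrix.trace_fin_two,
      Matrix.det_fin_two, smul_mul_assoc, one_mul]
    ext i j
    fin_cases i <;> fin_cases j <;>
      simp [pow_two, Matrix.mul_apply, Fin.sum_univ_two, -zsmul_eq_mul, -zsmul_one] <;> ring
  have ht : Algebra.trace ℤ (𝓞 K) x = M.trace := Algebra.trace_eq_matrix_trace b x
  have h1 : Algebra.trace ℤ (𝓞 K) 1 = 2 := by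
    rw [Algebra.trace_eq_matrix_trace b]; simp
  have ht2 : Algebra.trace ℤ (𝓞 K) (x * x) = M.trace ^ 2 - 2 * M.det := by
    have : x * x = M.trace • x - M.det • (1 : 𝓞 K) := by
      simp only [zsmul_eq_mul]; linear_combination hx2
    rw [this, map_sub, map_smul, map_smul, ht, h1]
    simp; ring
  let P : Matrix (Fin 2) (Fin 2) ℤ := (b.toMatrix ![1, x])
  have hP := Algebra.discr_of_matrix_vecMul (A := ℤ) (⇑b) P
  refine ⟨M.trace, M.det, P.det ^ 2, hx2, ?_⟩
  rw [← discr_eq_discr K b, ← hP]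
  have hv : Matrix.vecMul (⇑b) (P.map (algebraMap ℤ (𝓞 K))) = ![1, x] := by
    ext1 j
    have := b.sum_repr (![1, x] j)
    rw [← this]
    simp only [Matrix.vecMul, dotProduct, Matrix.map_apply]
    apply Finset.sum_congr rfl
    intro i _
    simp [P, Module.Basis.toMatrix_apply, mul_comm]
  rw [hv, Algebra.discr_def]
  rw [Matrix.det_fin_two (Algebra.traceMatrix ℤ ![1, x])]
  simp only [Algebra.traceMatrix_apply, Algebra.traceForm_apply, Matrix.cons_val_zero,
    Matrix.cons_val_one, one_mul, mul_one, ht, ht2, h1]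
  ring

lemma nonint (hdeg : Module.finrank ℚ K = 2) (hdisc : 11 < |discr K|) (φ : K →+* ℂ)
    (x : 𝓞 K) (hx : (φ x).im ≠ 0) : ∃ t n : ℤ,
    x ^ 2 - t * x + n = 0 ∧ 12 ≤ 4 * n - t ^ 2 ∧ ‖φ x‖ ^ 2 = n := by
  obtain ⟨t, n, c, h1, h2⟩ := quad hdeg x
  have h3 : φ x ^ 2 - t * φ x + n = 0 := by
    have := congrArg (fun y : 𝓞 K => φ (y : K)) h1
    simpa using this
  have hre := congrArg Complex.re h3
  have him := congrArg Complex.im h3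
  simp [pow_two] at hre him
  have ht : (t : ℝ) = 2 * (φ x).re := by
    apply mul_right_cancel₀ hx; linarith
  have hn : ‖φ x‖ ^ 2 = n := by
    rw [Complex.sq_norm, Complex.normSq_apply]; rw [ht] at hre; linarith
  refine ⟨t, n, h1, ?_, hn⟩
  have hpos : 0 < 4 * n - t ^ 2 := by
    have : (0 : ℝ) < 4 * n - t ^ 2 := by
      rw [← hn, ht, Complex.sq_norm, Complex.normSq_apply]
      have := sq_pos_of_ne_zero hx
      nlinarith
    exact_mod_cast this
  have hd : discr K ∣ 4 * n - t ^ 2 := ⟨-c, by linear_combination -h2⟩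
  have := Int.le_of_dvd hpos ((abs_dvd _ _).mpr hd)
  omega

lemma exists_s (φ : K →+* ℂ) (himag : IsEmpty (K →+* ℝ)) :
    ∃ x : 𝓞 K, (φ x).im ≠ 0 := by
  by_contra! h
  refine himag.false (RingHom.mk ⟨⟨fun z => (φ z).re, by simp⟩, ?_⟩ (by simp) (by simp))
  have hr : ∀ z : K, (φ z).im = 0 := by
    intro z
    obtain ⟨a, b, hb, rfl⟩ := IsFractionRing.div_surjective (A := 𝓞 K) z
    rw [map_div₀]
    have h1 := h a
    have h2 := h b
    simp [Complex.div_im] at *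
    simp [h1, h2]
  intro a b
  simp [hr]

lemma four (hdeg : Module.finrank ℚ K = 2) (himag : IsEmpty (K →+* ℝ))
    (hdisc : 11 < |discr K|) (φ : K →+* ℂ)
    (x : 𝓞 K) : ∃ n : ℤ, ‖φ x‖ ^ 2 = n ∧ (x = 0 ∨ x = 1 ∨ x = -1 ∨ 4 ≤ n) := by
  by_cases hx : (φ x).im = 0
  · obtain ⟨k, rfl⟩ := real_int hdeg himag φ x hx
    refine ⟨k ^ 2, by simp, ?_⟩
    by_cases h0 : k = 0
    · simp [h0]
    by_cases h1 : k = 1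
    · simp [h1]
    by_cases h2 : k = -1
    · simp [h2]
    right; right; right
    have : k ≤ -2 ∨ 2 ≤ k := by omega
    rcases this with h | h <;> nlinarith
  · obtain ⟨t, n, h1, h2, h3⟩ := nonint hdeg hdisc φ x hx
    refine ⟨n, h3, Or.inr (Or.inr (Or.inr ?_))⟩
    by_contra! hn
    have ht : t ^ 2 = 0 := by nlinarith [sq_nonneg t]
    have ht : t = 0 := by simpa using ht
    have hn3 : n = 3 := by subst ht; omega
    subst ht hn3
    have hx3 : (x : K) ^ 2 = -3 := by
      have := congrArg (fun y : 𝓞 K => (y : K)) h1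
      have h3' : algebraMap (𝓞 K) K 3 = 3 := map_ofNat _ 3
      simp [h3'] at this
      linear_combination this
    have hint : IsIntegral ℤ ((1 + (x : K)) / 2) := by
      refine ⟨Polynomial.X ^ 2 - Polynomial.X + 1, by monicity!, ?_⟩
      simp
      linear_combination hx3 / 4
    let y : 𝓞 K := ⟨_, hint⟩
    have hy : φ (y : K) = (1 + φ x) / 2 := by
      change φ ((1 + (x : K)) / 2) = _
      have h2' : φ 2 = 2 := map_ofNat _ 2
      simp [h2']
    have hre : (φ x).re = 0 := by
      have h4 : φ x ^ 2 = -3 := by rw [← map_pow, hx3, map_neg, map_ofNat]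
      have := congrArg Complex.im h4
      simp [pow_two] at this
      have : (φ x).re * (φ x).im = 0 := by linarith
      exact (mul_eq_zero.mp this).resolve_right hx
    have hyim : (φ y).im ≠ 0 := by
      rw [hy]; simpa using hx
    obtain ⟨t', n', -, h5, h6⟩ := nonint hdeg hdisc φ y hyim
    have : ‖φ y‖ ^ 2 = 1 := by
      rw [Complex.sq_norm, Complex.normSq_apply] at h3 ⊢
      rw [hy]
      simp [hre] at h3 ⊢
      linarith
    rw [h6] at this
    have : n' = 1 := by exact_mod_cast this
    nlinarith [sq_nonneg t']


lemma main (hdeg : Module.finrank ℚ K = 2) (himag : IsEmpty (K →+* ℝ))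
    (hdisc : 11 < |discr K|) : (E (𝓞 K)).index = 0 ∧ ¬ (E (𝓞 K)).Normal := by
  obtain ⟨φ⟩ : Nonempty (K →+* ℂ) := inferInstance
  let ψ : 𝓞 K →+* ℂ := φ.comp (algebraMap (𝓞 K) K)
  have hint : ∀ x : 𝓞 K, ∃ n : ℤ, ‖ψ x‖ ^ 2 = n := fun x => by
    obtain ⟨n, hn, -⟩ := four hdeg himag hdisc φ x
    exact ⟨n, hn⟩
  have h4 : ∀ x : 𝓞 K, x = 0 ∨ x = 1 ∨ x = -1 ∨ 2 ≤ ‖ψ x‖ := fun x => by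
    obtain ⟨n, hn, h | h | h | h⟩ := four hdeg himag hdisc φ x
    · exact Or.inl h
    · exact Or.inr (Or.inl h)
    · exact Or.inr (Or.inr (Or.inl h))
    · right; right; right
      change 2 ≤ ‖φ x‖
      have h' : (4 : ℝ) ≤ n := by exact_mod_cast h
      nlinarith [norm_nonneg (φ x)]
  obtain ⟨x, hx⟩ := exists_s φ himag
  obtain ⟨t, n, h1, h2, h3⟩ := nonint hdeg hdisc φ x hx
  have hs : (2 * x - t) ^ 2 = -((4 * n - t ^ 2 : ℤ) : 𝓞 K) := by
    push_cast
    linear_combination 4 * h1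
  have hsq : ¬ IsSquare (4 * n - t ^ 2) := by
    rintro ⟨k, hk⟩
    have hk0 : k ≠ 0 := by rintro rfl; omega
    have hkK : (k : K) ≠ 0 := by exact_mod_cast hk0
    have hsK : (2 * (x : K) - t) ^ 2 = -(k ^ 2 : K) := by
      have h2' : algebraMap (𝓞 K) K 2 = 2 := map_ofNat _ 2
      have := congrArg (fun y : 𝓞 K => (y : K)) hs
      rw [hk] at this
      simp [h2'] at this
      linear_combination this
    have hi2 : ((2 * (x : K) - t) / k) ^ 2 = -1 := by
      rw [div_pow, hsK]; field_simp
    have hi : IsIntegral ℤ ((2 * (x : K) - t) / k) := by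
      refine ⟨Polynomial.X ^ 2 + 1, by monicity!, ?_⟩
      simp only [Polynomial.eval₂_add, Polynomial.eval₂_pow, Polynomial.eval₂_X,
        Polynomial.eval₂_one, hi2]
      ring
    let y : 𝓞 K := ⟨_, hi⟩
    have hy : y * y = -1 := by
      apply RingOfIntegers.ext
      have : (y : K) ^ 2 = -1 := hi2
      simp [← this, pow_two]
    have hu := units_of ψ h4 y (-y) (by linear_combination -hy)
    have h0 : (2 : 𝓞 K) ≠ 0 := two_ne_zero
    apply h0
    rcases hu with h | h
    · linear_combination -h.1 - h.2
    · linear_combination h.1 + h.2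
  exact ⟨index_zero ψ h4 hint (by omega) hsq hs, not_normal ψ h4 hint (by omega) hsq hs⟩

end nf
end ElemSL



/-- For an imaginary quadratic number field `K` with `|disc K| > 11`,
the subgroup of `SL(2, 𝒪_K)` generated by the upper and lower triangular matrices has
infinite index and is not normal. -/
theorem elementary_subgroup_infinite_index_not_normal
    (K : Type*) [Field K] [NumberField K]
    (hdeg : Module.finrank ℚ K = 2) (himag : IsEmpty (K →+* ℝ))
    (hdisc : 11 < |NumberField.discr K|) :
    (Subgroup.closure
      {M : Matrix.SpecialLinearGroup (Fin 2) (NumberField.RingOfIntegers K) |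
        (M : Matrix (Fin 2) (Fin 2) (NumberField.RingOfIntegers K)) 1 0 = 0 ∨
        (M : Matrix (Fin 2) (Fin 2) (NumberField.RingOfIntegers K)) 0 1 = 0}).index = 0 ∧
    ¬ (Subgroup.closure
      {M : Matrix.SpecialLinearGroup (Fin 2) (NumberField.RingOfIntegers K) |
        (M : Matrix (Fin 2) (Fin 2) (NumberField.RingOfIntegers K)) 1 0 = 0 ∨
        (M : Matrix (Fin 2) (Fin 2) (NumberField.RingOfIntegers K)) 0 1 = 0}).Normal := by
  exact ElemSL.main hdeg himag hdisc
end

section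
/- Let K be an imaginary quadratic number field (a number field of degree 2 over ℚ admitting no real embedding) with ring of integers 𝒪_K. Then SL(2, 𝒪_K) is generated by its upper triangular and lower triangular matrices if and only if the discriminant of K belongs to {−3, −4, −7, −8, −11}. -/
inductive GoodPair {R : Type*} [CommRing R] (f : R →+* ℂ) : R → R → Prop
  | one : GoodPair f 0 1
  | neg_one : GoodPair f 0 (-1)
  | step (a b q : R) : GoodPair f a b → 2 ≤ ‖f q‖ → GoodPair f b (q * b + a)

section
variable {R : Type*} [CommRing R] {f : R →+* ℂ}

theorem GoodPair.lt {a b : R} (h : GoodPair f a b) : ‖f a‖ < ‖f b‖ := by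
  induction h with
  | one => simp
  | neg_one => simp
  | step a b q h hq ih =>
    have h1 : ‖f q * f b‖ ≤ ‖f (q * b + a)‖ + ‖f a‖ := by
      have : f q * f b = f (q * b + a) - f a := by simp
      rw [this]; exact norm_sub_le _ _
    rw [norm_mul] at h1
    nlinarith [norm_nonneg (f a), norm_nonneg (f b)]

theorem GoodPair.signs {a b : R} (h : GoodPair f a b) :
    GoodPair f (-a) b ∧ GoodPair f a (-b) ∧ GoodPair f (-a) (-b) := by
  induction h with
  | one => simpa using ⟨GoodPair.one, GoodPair.neg_one⟩
  | neg_one => simpa using ⟨GoodPair.neg_one, GoodPair.one⟩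
  | step a b q h hq ih =>
    obtain ⟨h1, h2, h3⟩ := ih
    have hq' : 2 ≤ ‖f (-q)‖ := by simpa using hq
    refine ⟨?_, ?_, ?_⟩
    · have := GoodPair.step _ _ (-q) h2 hq'
      convert this using 1; ring
    · have := GoodPair.step _ _ (-q) h1 hq'
      convert this using 1; ring
    · have := GoodPair.step _ _ q h3 hq
      convert this using 1; ring

def WOne (f : R →+* ℂ) (a b : R) : Prop := ∃ q, GoodPair f (a + q * b) b

theorem WOne.add {a b : R} (h : WOne f a b) (r : R) : WOne f (a + r * b) b := by
  obtain ⟨q, h⟩ := h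
  refine ⟨q - r, ?_⟩
  convert h using 1; ring

theorem WOne.neg_left {a b : R} (h : WOne f a b) : WOne f (-a) b := by
  obtain ⟨q, h⟩ := h
  refine ⟨-q, ?_⟩
  convert h.signs.1 using 1; ring

theorem WOne.neg_right {a b : R} (h : WOne f a b) : WOne f a (-b) := by
  obtain ⟨q, h⟩ := h
  refine ⟨-q, ?_⟩
  convert h.signs.2.1 using 1; ring

theorem GoodPair.unit_case (hR : ∀ q : R, ‖f q‖ < 2 → q = 0 ∨ q = 1 ∨ q = -1)
    {c a : R} (h : GoodPair f c a) : WOne f a (c - a) ∧ WOne f a (c + a) := by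
  induction h with
  | one =>
    refine ⟨⟨1, ?_⟩, ⟨-1, ?_⟩⟩
    · simpa using GoodPair.neg_one
    · simpa using GoodPair.one
  | neg_one =>
    refine ⟨⟨1, ?_⟩, ⟨-1, ?_⟩⟩
    · simpa using GoodPair.one
    · simpa using GoodPair.neg_one
  | step d c p h hp ih =>
    constructor
    · by_cases h2 : 2 ≤ ‖f (1 - p)‖
      · have h3 := GoodPair.step _ _ _ h.signs.1 h2
        refine ⟨1, ?_⟩
        convert h3 using 1 <;> ring
      · have hp2 : p = 2 := by
          rcases hR _ (not_le.1 h2) with h3 | h3 | h3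
          · have : p = 1 := by linear_combination -h3
            subst this; norm_num at hp
          · have : p = 0 := by linear_combination -h3
            subst this; norm_num at hp
          · linear_combination -h3
        subst hp2
        -- a = 2c+d, c - a = -(c+d)
        have := (ih.2.neg_right).add (-1)
        convert this using 1 <;> ring
    · by_cases h2 : 2 ≤ ‖f (1 + p)‖
      · have h3 := GoodPair.step _ _ _ h h2
        refine ⟨-1, ?_⟩
        convert h3.signs.1 using 1 <;> ring
      · have hp2 : p = -2 := by
          rcases hR _ (not_le.1 h2) with h3 | h3 | h3
          · have : p = -1 := by linear_combination h3
            subst this; norm_num at hp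
          · have : p = 0 := by linear_combination h3
            subst this; norm_num at hp
          · linear_combination h3
        subst hp2
        -- a = -2c+d, c + a = d - c
        have := (ih.1.neg_left).add (1)
        convert this using 1 <;> ring

theorem WOne.swap_add (hR : ∀ q : R, ‖f q‖ < 2 → q = 0 ∨ q = 1 ∨ q = -1)
    {a b : R} (h : WOne f b a) (r : R) : WOne f (a + r * b) b ∨ WOne f b (a + r * b) := by
  obtain ⟨q, h⟩ := h
  by_cases h2 : 2 ≤ ‖f q‖
  · left
    have h3 := GoodPair.step _ _ (-q) h (by simpa using h2)
    refine WOne.add ⟨0, ?_⟩ r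
    convert h3 using 1 <;> ring
  · rcases hR _ (not_le.1 h2) with h3 | h3 | h3
    · subst h3
      generalize hc : b + 0 * a = c at h
      have hc' : b = c := by rw [← hc]; ring
      subst hc'
      cases h with
      | one => right; exact ⟨0, by simpa using GoodPair.one⟩
      | neg_one => right; exact ⟨0, by simpa using GoodPair.neg_one⟩
      | step d _ p h hp =>
        left
        refine ⟨-p - r, ?_⟩
        convert h using 1; ring
    · subst h3
      left
      apply WOne.add
      convert (h.unit_case hR).1 using 1; ring
    · subst h3
      left
      apply WOne.add
      convert (h.unit_case hR).2 using 1; ring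

def WPair (f : R →+* ℂ) (a b : R) : Prop := WOne f a b ∨ WOne f b a

theorem WPair.symm {a b : R} (h : WPair f a b) : WPair f b a := Or.symm h

theorem WPair.add (hR : ∀ q : R, ‖f q‖ < 2 → q = 0 ∨ q = 1 ∨ q = -1)
    {a b : R} (h : WPair f a b) (r : R) : WPair f (a + r * b) b := by
  rcases h with h | h
  · exact Or.inl (h.add r)
  · exact h.swap_add hR r

theorem WPair.neg_left {a b : R} (h : WPair f a b) : WPair f (-a) b := by
  rcases h with h | h
  · exact Or.inl h.neg_left
  · exact Or.inr h.neg_right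

theorem WPair.tri (hR : ∀ q : R, ‖f q‖ < 2 → q = 0 ∨ q = 1 ∨ q = -1)
    {a b : R} (h : WPair f a b) (u w r : R) (huw : u * w = 1) :
    WPair f (a * u + b * r) (b * w) := by
  have key : ∀ u w : R, u * w = 1 → ‖f u‖ ≤ 1 → u = w ∧ (u = 1 ∨ u = -1) := by
    intro u w huw hu
    rcases hR u (by linarith) with h | h | h
    · subst h
      have := congrArg f huw
      simp at this
    · subst h; simp at huw; simp [huw]
    · subst h
      refine ⟨?_, Or.inr rfl⟩
      linear_combination huw
  have h1 : u = w ∧ (u = 1 ∨ u = -1) := by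
    have hn : ‖f u‖ * ‖f w‖ = 1 := by rw [← norm_mul, ← map_mul, huw]; simp
    rcases le_total ‖f u‖ 1 with h | h
    · exact key u w huw h
    · have : ‖f w‖ ≤ 1 := by nlinarith [norm_nonneg (f w)]
      obtain ⟨e, h2⟩ := key w u (by rw [mul_comm]; exact huw) this
      subst e; exact ⟨rfl, h2⟩
  obtain ⟨rfl, h1 | h1⟩ := h1
  · subst h1
    convert h.add hR r using 1 <;> ring
  · subst h1
    convert (h.neg_left.symm.neg_left.symm.add hR (-r)) using 1 <;> ring

theorem WPair.irred_aux {a b : R} (hR : ∀ q : R, ‖f q‖ < 2 → q = 0 ∨ q = 1 ∨ q = -1)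
    (ha : a ≠ 0)
    (h1 : ∀ q, ‖f a‖ ≤ ‖f (a + q * b)‖) (h2 : ∀ q, ‖f b‖ ≤ ‖f (b + q * a)‖)
    (h3 : ‖f b‖ ≤ ‖f (a + b)‖) (h4 : ‖f b‖ ≤ ‖f (a - b)‖) : ¬ WOne f a b := by
  rintro ⟨q, h⟩
  have hlt := h.lt
  by_cases hq : 2 ≤ ‖f q‖
  · have := h1 q
    have h5 : ‖f q * f b‖ ≤ ‖f (a + q * b)‖ + ‖f a‖ := by
      have : f q * f b = f (a + q * b) - f a := by simp
      rw [this]; exact norm_sub_le _ _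
    rw [norm_mul] at h5
    nlinarith [norm_nonneg (f a), norm_nonneg (f b)]
  · rcases hR _ (not_le.1 hq) with e | e | e
    · subst e
      generalize hc : a + 0 * b = c at h
      have hc' : a = c := by rw [← hc]; ring
      subst hc'
      cases h with
      | one => exact ha rfl
      | neg_one => exact ha rfl
      | step d _ p h hp =>
        have h5 := h2 (-p)
        have h6 := h.lt
        have e : p * a + d + -p * a = d := by ring
        rw [e] at h5
        have h7 := hlt
        simp only [zero_mul, add_zero] at h7
        linarith
    · subst e; rw [one_mul] at hlt; linarith
    · subst e
      have : a + -1 * b = a - b := by ring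
      rw [this] at hlt; linarith

theorem closure_ne_top (hR : ∀ q : R, ‖f q‖ < 2 → q = 0 ∨ q = 1 ∨ q = -1)
    (a b c d : R) (ha : a ≠ 0) (hb : b ≠ 0) (hdet : a * d - b * c = 1)
    (h1 : ∀ q, ‖f a‖ ≤ ‖f (a + q * b)‖) (h2 : ∀ q, ‖f b‖ ≤ ‖f (b + q * a)‖)
    (h3 : ‖f b‖ ≤ ‖f (a + b)‖) (h4 : ‖f b‖ ≤ ‖f (a - b)‖)
    (h5 : ‖f a‖ ≤ ‖f (a + b)‖) (h6 : ‖f a‖ ≤ ‖f (a - b)‖) :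
    Subgroup.closure {M : Matrix.SpecialLinearGroup (Fin 2) R |
        (M : Matrix (Fin 2) (Fin 2) R) 1 0 = 0 ∨
        (M : Matrix (Fin 2) (Fin 2) R) 0 1 = 0} ≠ ⊤ := by
  intro htop
  have hmul : ∀ x g : Matrix.SpecialLinearGroup (Fin 2) R,
      (g.1 1 0 = 0 ∨ g.1 0 1 = 0) → WPair f (x.1 0 0) (x.1 0 1) →
      WPair f ((x * g).1 0 0) ((x * g).1 0 1) := by
    intro x g hg hx
    have hd : g.1 0 0 * g.1 1 1 - g.1 0 1 * g.1 1 0 = 1 := by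
      rw [← Matrix.det_fin_two]; exact g.2
    have e0 : (x * g).1 0 0 = x.1 0 0 * g.1 0 0 + x.1 0 1 * g.1 1 0 := by
      simp [Matrix.mul_apply, Fin.sum_univ_two]
    have e1 : (x * g).1 0 1 = x.1 0 0 * g.1 0 1 + x.1 0 1 * g.1 1 1 := by
      simp [Matrix.mul_apply, Fin.sum_univ_two]
    rw [e0, e1]
    rcases hg with hg | hg
    · rw [hg] at hd ⊢
      have := (hx.symm.tri hR (g.1 1 1) (g.1 0 0) (g.1 0 1) (by linear_combination hd)).symm
      convert this using 1 <;> ring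
    · rw [hg] at hd ⊢
      have := (hx.tri hR (g.1 0 0) (g.1 1 1) (g.1 1 0) (by linear_combination hd))
      convert this using 1 ; ring
  have hall : ∀ M ∈ Subgroup.closure {M : Matrix.SpecialLinearGroup (Fin 2) R |
        (M : Matrix (Fin 2) (Fin 2) R) 1 0 = 0 ∨
        (M : Matrix (Fin 2) (Fin 2) R) 0 1 = 0}, WPair f (M.1 0 0) (M.1 0 1) := by
    intro M hM
    induction hM using Subgroup.closure_induction_right with
    | one => exact Or.inr ⟨0, by simpa using GoodPair.one⟩
    | mul_right x hx y hy ih => exact hmul x y hy ih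
    | mul_inv_cancel x hx y hy ih =>
      refine hmul x y⁻¹ ?_ ih
      have hy' : y.1 1 0 = 0 ∨ y.1 0 1 = 0 := hy
      simpa [Matrix.SpecialLinearGroup.coe_inv, Matrix.adjugate_fin_two] using hy'
  have hM := hall ⟨!![a, b; c, d], by rw [Matrix.det_fin_two_of]; exact hdet⟩
    (by rw [htop]; trivial)
  simp at hM
  rcases hM with hM | hM
  · exact WPair.irred_aux hR ha h1 h2 h3 h4 hM
  · refine WPair.irred_aux hR hb h2 h1 (by rwa [add_comm]) ?_ hM
    rw [← neg_sub, map_neg, norm_neg]; exact h6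

theorem closure_eq_top_of_euclid {R : Type*} [CommRing R] (N : R → ℕ)
    (hN : ∀ a b : R, b ≠ 0 → ∃ q, N (a - q * b) < N b) :
    Subgroup.closure {M : Matrix.SpecialLinearGroup (Fin 2) R |
        (M : Matrix (Fin 2) (Fin 2) R) 1 0 = 0 ∨
        (M : Matrix (Fin 2) (Fin 2) R) 0 1 = 0} = ⊤ := by
  set H := Subgroup.closure {M : Matrix.SpecialLinearGroup (Fin 2) R |
        (M : Matrix (Fin 2) (Fin 2) R) 1 0 = 0 ∨
        (M : Matrix (Fin 2) (Fin 2) R) 0 1 = 0} with hH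
  have hU : ∀ q : R, ∃ S ∈ H, S.1 = !![1, q; 0, 1] := fun q =>
    ⟨⟨!![1, q; 0, 1], by simp [Matrix.det_fin_two_of]⟩,
      Subgroup.subset_closure (Or.inl (by simp)), rfl⟩
  have hL : ∀ q : R, ∃ S ∈ H, S.1 = !![1, 0; q, 1] := fun q =>
    ⟨⟨!![1, 0; q, 1], by simp [Matrix.det_fin_two_of]⟩,
      Subgroup.subset_closure (Or.inr (by simp)), rfl⟩
  have hS : ∀ q : R, ∃ S ∈ H, S.1 = !![-q, -1; 1, 0] := by
    intro q
    obtain ⟨A, hA, eA⟩ := hU (-q - 1)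
    obtain ⟨B, hB, eB⟩ := hL 1
    obtain ⟨C, hC, eC⟩ := hU (-1)
    refine ⟨A * B * C, H.mul_mem (H.mul_mem hA hB) hC, ?_⟩
    rw [Matrix.SpecialLinearGroup.coe_mul, Matrix.SpecialLinearGroup.coe_mul, eA, eB, eC]
    simp
    ring
  rw [eq_top_iff]
  have key : ∀ k : ℕ, ∀ M : Matrix.SpecialLinearGroup (Fin 2) R, N (M.1 1 0) = k → M ∈ H := by
    intro k
    induction k using Nat.strong_induction_on with
    | _ k ih =>
      intro M hk
      by_cases h0 : M.1 1 0 = 0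
      · exact Subgroup.subset_closure (Or.inl h0)
      · obtain ⟨q, hq⟩ := hN (M.1 1 1) (M.1 1 0) h0
        obtain ⟨S, hSH, hS'⟩ := hS q
        have e : (M * S).1 1 0 = M.1 1 1 - q * M.1 1 0 := by
          rw [Matrix.SpecialLinearGroup.coe_mul, Matrix.mul_apply, Fin.sum_univ_two, hS']
          simp
          ring
        have h1 := ih (N (M.1 1 1 - q * M.1 1 0)) (by rw [← hk]; exact hq) (M * S) (by rw [e])
        exact (H.mul_mem_cancel_right hSH).1 h1
  intro M _
  exact key _ M rfl
end
open NumberField in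
theorem exists_omega (K : Type*) [Field K] [NumberField K]
    (hdeg : Module.finrank ℚ K = 2) :
    ∃ (ω : 𝓞 K) (t n : ℤ), (t = 0 ∨ t = 1) ∧ ω * ω = t * ω - n ∧
      (∀ r : 𝓞 K, ∃ u v : ℤ, r = u + v * ω) ∧ NumberField.discr K = t ^ 2 - 4 * n := by
  have hrank : Module.finrank ℤ (𝓞 K) = 2 := by rw [RingOfIntegers.rank, hdeg]
  let b := Module.finBasisOfFinrankEq ℤ (𝓞 K) hrank
  have hb : ∀ r : 𝓞 K, ∃ u v : ℤ, r = u * b 0 + v * b 1 := by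
    intro r
    refine ⟨b.repr r 0, b.repr r 1, ?_⟩
    have := b.sum_repr r
    rw [Fin.sum_univ_two] at this
    simpa [zsmul_eq_mul] using this.symm
  obtain ⟨x, y, hxy⟩ := hb 1
  have hcop : IsCoprime x y := by
    rw [Int.isCoprime_iff_gcd_eq_one]
    obtain ⟨x', hx'⟩ := Int.gcd_dvd_left x y
    obtain ⟨y', hy'⟩ := Int.gcd_dvd_right x y
    generalize Int.gcd x y = g at *
    have h1 : (1 : 𝓞 K) = algebraMap ℤ (𝓞 K) g * (x' * b 0 + y' * b 1) := by
      rw [hxy, hx', hy']; push_cast; ring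
    have h2 := congrArg (Algebra.norm ℤ) h1
    rw [map_mul, Algebra.norm_algebraMap, map_one, hrank] at h2
    have h3 : (g : ℤ) ∣ 1 := ⟨_, by rw [h2, pow_two, mul_assoc]⟩
    have := Int.natCast_dvd_natCast.1 (by simpa using h3 : (g : ℤ) ∣ (1 : ℕ))
    simpa using this
  obtain ⟨p, q, hpq⟩ := hcop
  have hpq' : (p : 𝓞 K) * x + q * y = 1 := by exact_mod_cast congrArg (Int.cast (R := 𝓞 K)) hpq
  obtain ⟨ω₀, hω₀⟩ : ∃ ω₀ : 𝓞 K, ω₀ = -q * b 0 + p * b 1 := ⟨_, rfl⟩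
  have hs0 : ∀ r : 𝓞 K, ∃ u v : ℤ, r = u + v * ω₀ := by
    intro r
    obtain ⟨u, v, huv⟩ := hb r
    refine ⟨u * p + v * q, -u * y + v * x, ?_⟩
    have e0 : b 0 = p - y * ω₀ := by
      rw [hω₀]; linear_combination -p * hxy - b 0 * hpq'
    have e1 : b 1 = q + x * ω₀ := by
      rw [hω₀]; linear_combination -q * hxy - b 1 * hpq'
    rw [huv, e0, e1]; push_cast; ring
  obtain ⟨n₀, t₀, h0⟩ := hs0 (ω₀ * ω₀)
  obtain ⟨k, t, ht, hkt⟩ : ∃ k t : ℤ, (t = 0 ∨ t = 1) ∧ t₀ = 2 * k + t :=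
    ⟨t₀ / 2, t₀ % 2, by omega, by omega⟩
  subst hkt
  obtain ⟨ω, hω⟩ : ∃ ω : 𝓞 K, ω = ω₀ - k := ⟨_, rfl⟩
  have hω₀' : ω₀ = ω + k := by rw [hω]; ring
  subst hω₀'
  have hs : ∀ r : 𝓞 K, ∃ u v : ℤ, r = u + v * ω := by
    intro r
    obtain ⟨u, v, huv⟩ := hs0 r
    exact ⟨u + v * k, v, by rw [huv]; push_cast; ring⟩
  obtain ⟨n, hn⟩ : ∃ n : ℤ, ω * ω = t * ω - n :=
    ⟨-(n₀ + (2 * k + t) * k - k * k), by push_cast at h0 ⊢; linear_combination h0⟩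
  refine ⟨ω, t, n, ht, hn, hs, ?_⟩
  have hspan : ⊤ ≤ Submodule.span ℤ (Set.range ![(1 : 𝓞 K), ω]) := by
    intro r _
    obtain ⟨u, v, rfl⟩ := hs r
    refine Submodule.add_mem _ ?_ ?_
    · rw [← mul_one (u : 𝓞 K), ← zsmul_eq_mul]
      exact Submodule.smul_mem _ _ (Submodule.subset_span ⟨0, rfl⟩)
    · rw [← zsmul_eq_mul]
      exact Submodule.smul_mem _ _ (Submodule.subset_span ⟨1, rfl⟩)
  let B := basisOfTopLeSpanOfCardEqFinrank ![(1 : 𝓞 K), ω] hspan (by simp [hrank])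
  have hB : ⇑B = ![(1 : 𝓞 K), ω] := coe_basisOfTopLeSpanOfCardEqFinrank _ _ _
  have hB0 : B 0 = 1 := by rw [hB]; rfl
  have hB1 : B 1 = ω := by rw [hB]; rfl
  have tr1 : Algebra.trace ℤ (𝓞 K) 1 = 2 := by
    have := Algebra.trace_algebraMap (R := ℤ) (S := 𝓞 K) 1
    rw [map_one, hrank] at this
    simpa using this
  have trω : Algebra.trace ℤ (𝓞 K) ω = t := by
    rw [Algebra.trace_eq_matrix_trace B, Matrix.trace_fin_two,
      Algebra.leftMulMatrix_eq_repr_mul, Algebra.leftMulMatrix_eq_repr_mul, hB0, hB1, mul_one, hn]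
    have e : (t : 𝓞 K) * ω - n = t • B 1 - n • B 0 := by simp [hB0, hB1]
    rw [e]
    nth_rw 1 [← hB1]
    simp [-zsmul_eq_mul]
  have trωω : Algebra.trace ℤ (𝓞 K) (ω * ω) = t * t - 2 * n := by
    have e : ω * ω = t • ω - n • (1 : 𝓞 K) := by rw [hn]; simp
    rw [e, map_sub, map_smul, map_smul, trω, tr1]
    simp; ring
  rw [← NumberField.discr_eq_discr K B, Algebra.discr_def, Matrix.det_fin_two]
  simp only [Algebra.traceMatrix_apply, Algebra.traceForm_apply, hB0, hB1, mul_one, one_mul, tr1,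
    trω, trωω]
  ring

open NumberField in
theorem omega_im_ne (K : Type*) [Field K] [NumberField K] (himag : IsEmpty (K →+* ℝ))
    (φ : K →+* ℂ) (ω : 𝓞 K) (hs : ∀ r : 𝓞 K, ∃ u v : ℤ, r = u + v * ω) :
    (φ ω).im ≠ 0 := by
  intro h
  have hreal : ComplexEmbedding.IsReal φ := by
    rw [ComplexEmbedding.isReal_iff]
    apply IsLocalization.ringHom_ext (nonZeroDivisors (𝓞 K))
    ext r
    obtain ⟨u, v, rfl⟩ := hs r
    have : (starRingEnd ℂ) (φ ω) = φ ω := Complex.conj_eq_iff_im.2 h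
    simp [ComplexEmbedding.conjugate_coe_eq, this]
  exact himag.false hreal.embedding

theorem main_aux {R : Type*} [CommRing R] (f : R →+* ℂ) (hf : Function.Injective f)
    (ω : R) (t n : ℤ) (ht : t = 0 ∨ t = 1)
    (hω : ω * ω = t * ω - n) (hs : ∀ r : R, ∃ u v : ℤ, r = u + v * ω) (him : (f ω).im ≠ 0)
    (hpar3 : ¬ ∃ j : R, 1 + ω = j + j ∧ n = 3 ∧ t = 0)
    (hpar4 : ¬ ∃ j : R, ω = j + j ∧ n = 4 ∧ t = 0)
    (hn3 : n = 3 → t = 0 → ∃ j : R, 1 + ω = j + j)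
    (hn4 : n = 4 → t = 0 → ∃ j : R, ω = j + j) :
    (Subgroup.closure {M : Matrix.SpecialLinearGroup (Fin 2) R |
        (M : Matrix (Fin 2) (Fin 2) R) 1 0 = 0 ∨
        (M : Matrix (Fin 2) (Fin 2) R) 0 1 = 0} = ⊤) ↔
      t ^ 2 - 4 * n ∈ ({-3, -4, -7, -8, -11} : Set ℤ) := by
  have hz : f ω * f ω = t * f ω - n := by rw [← map_mul, hω]; simp
  have hre : (f ω).re = t / 2 := by
    have := congrArg Complex.im hz
    simp at this
    have : (f ω).im * (2 * (f ω).re - t) = 0 := by linarith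
    rcases mul_eq_zero.1 this with h | h
    · exact absurd h him
    · linarith
  have him2 : (f ω).im ^ 2 = n - t ^ 2 / 4 := by
    have := congrArg Complex.re hz
    simp [hre] at this
    nlinarith
  have hD : t ^ 2 - 4 * n < 0 := by
    have : 0 < (f ω).im ^ 2 := by positivity
    rw [him2] at this
    have : ((t ^ 2 - 4 * n : ℤ) : ℝ) < 0 := by push_cast; linarith
    exact_mod_cast this
  have hn : 1 ≤ n := by nlinarith [sq_nonneg t]
  have hN : ∀ u v : ℤ, ‖f (u + v * ω)‖ ^ 2 = ((u ^ 2 + t * u * v + n * v ^ 2 : ℤ) : ℝ) := by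
    intro u v
    rw [Complex.sq_norm, Complex.normSq_apply]
    simp [hre]
    linear_combination (v : ℝ) ^ 2 * him2
  constructor
  · intro htop
    by_contra hmem
    simp only [Set.mem_insert_iff, Set.mem_singleton_iff, not_or] at hmem
    have hn3' : ¬ (n = 3 ∧ t = 0) := by
      rintro ⟨h1, h2⟩
      obtain ⟨j, hj⟩ := hn3 h1 h2
      exact hpar3 ⟨j, hj, h1, h2⟩
    have hn4' : ¬ (n = 4 ∧ t = 0) := by
      rintro ⟨h1, h2⟩
      obtain ⟨j, hj⟩ := hn4 h1 h2
      exact hpar4 ⟨j, hj, h1, h2⟩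
    have hn45 : 4 ≤ n ∧ (t = 0 → 5 ≤ n) := by
      rcases ht with rfl | rfl
      · omega
      · omega
    have hR : ∀ q : R, ‖f q‖ < 2 → q = 0 ∨ q = 1 ∨ q = -1 := by
      intro q hq
      obtain ⟨u, v, rfl⟩ := hs q
      have h1 : ‖f (u + v * ω)‖ ^ 2 < 4 := by nlinarith [norm_nonneg (f (u + v * ω))]
      rw [hN] at h1
      have h2 : u ^ 2 + t * u * v + n * v ^ 2 < 4 := by exact_mod_cast h1
      have h3 : v = 0 := by
        by_contra hv
        have : 1 ≤ v ^ 2 := by have := pow_pos (abs_pos.2 hv) 2; rw [sq_abs] at this; omega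
        rcases ht with rfl | rfl
        · nlinarith [sq_nonneg u]
        · have : 4 ∣ 4 * (u ^ 2 + u * v) + 0 := ⟨u ^ 2 + u * v, by ring⟩
          by_cases hv2 : v ^ 2 = 1
          · have hu : 0 ≤ u * (u + 1) := by
              rcases le_or_gt 0 u with h | h
              · positivity
              · exact mul_nonneg_of_nonpos_of_nonpos h.le (by omega)
            have hu' : 0 ≤ u * (u - 1) := by
              rcases le_or_gt u 0 with h | h
              · exact mul_nonneg_of_nonpos_of_nonpos h (by omega)
              · exact mul_nonneg h.le (by omega)
            rcases (show v = 1 ∨ v = -1 from by simpa using hv2) with rfl | rfl <;> nlinarith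
          · nlinarith [sq_nonneg (2 * u + v)]
      subst h3
      have h4 : u ^ 2 < 4 := by linarith
      have h5 : u < 2 := by nlinarith
      have h6 : -2 < u := by nlinarith
      have : u = 0 ∨ u = 1 ∨ u = -1 := by omega
      rcases this with rfl | rfl | rfl <;> simp
    have hle : ∀ u v u' v' : ℤ, u ^ 2 + t * u * v + n * v ^ 2 ≤ u' ^ 2 + t * u' * v' + n * v' ^ 2 →
        ‖f (u + v * ω)‖ ≤ ‖f (u' + v' * ω)‖ := by
      intro u v u' v' h
      apply le_of_sq_le_sq _ (norm_nonneg _)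
      rw [hN, hN]; exact_mod_cast h
    have hle' : ∀ (r r' : R) (u v u' v' : ℤ), r = u + v * ω → r' = u' + v' * ω →
        u ^ 2 + t * u * v + n * v ^ 2 ≤ u' ^ 2 + t * u' * v' + n * v' ^ 2 →
        ‖f r‖ ≤ ‖f r'‖ := by
      rintro r r' u v u' v' rfl rfl h
      exact hle u v u' v' h
    have hne : ∀ u v : ℤ, u ^ 2 + t * u * v + n * v ^ 2 ≠ 0 → (u + v * ω : R) ≠ 0 := by
      intro u v h h0
      have := hN u v
      rw [h0] at this
      simp only [map_zero, norm_zero] at this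
      apply h
      have h2 : ((u ^ 2 + t * u * v + n * v ^ 2 : ℤ) : ℝ) = 0 := by rw [← this]; norm_num
      exact_mod_cast h2
    rcases ht with rfl | rfl
    · have hn5 : 5 ≤ n := hn45.2 rfl
      have hω' : ω * ω = -n := by rw [hω]; simp
      refine closure_ne_top hR (2 * n + 1 : R) (n * ω) (4 * ω) (1 - 2 * n) ?_ ?_ ?_ ?_ ?_ ?_ ?_ ?_ ?_ htop
      · have := hne (2 * n + 1) 0 (by nlinarith)
        simpa using this
      · have := hne 0 n (by positivity)
        simpa using this
      · linear_combination -4 * n * hω'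
      · intro q
        obtain ⟨u, v, rfl⟩ := hs q
        refine hle' _ _ (2 * n + 1) 0 (2 * n + 1 - v * n * n) (u * n) (by simp) ?_ ?_
        · push_cast; linear_combination v * n * hω'
        · have h1 : 0 ≤ n * (u * n) ^ 2 := by positivity
          have h2 : 0 ≤ v * (v * (n * n) - 2 * (2 * n + 1)) := by
            rcases le_or_gt v 0 with hv | hv
            · exact mul_nonneg_of_nonpos_of_nonpos hv (by nlinarith)
            · have : 1 ≤ v := hv
              exact mul_nonneg hv.le (by nlinarith)
          have h3 := mul_nonneg (mul_nonneg (by linarith : 0 ≤ n) (by linarith : 0 ≤ n)) h2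
          nlinarith
      · intro q
        obtain ⟨u, v, rfl⟩ := hs q
        refine hle' _ _ 0 n (u * (2 * n + 1)) (n + v * (2 * n + 1)) (by simp) ?_ ?_
        · push_cast; ring
        · have h1 : 0 ≤ (u * (2 * n + 1)) ^ 2 := by positivity
          have h2 : 0 ≤ v * (v * (2 * n + 1) + 2 * n) := by
            rcases le_or_gt 0 v with hv | hv
            · positivity
            · have : v ≤ -1 := by omega
              exact mul_nonneg_of_nonpos_of_nonpos hv.le (by nlinarith)
          have h3 := mul_nonneg (mul_nonneg (by linarith : 0 ≤ n) (by linarith : 0 ≤ 2 * n + 1)) h2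
          nlinarith
      · refine hle' _ _ 0 n (2 * n + 1) n (by simp) (by push_cast; ring) (by nlinarith)
      · refine hle' _ _ 0 n (2 * n + 1) (-n) (by simp) (by push_cast; ring) (by nlinarith)
      · refine hle' _ _ (2 * n + 1) 0 (2 * n + 1) n (by simp) (by push_cast; ring) ?_
        have : 0 ≤ n * n ^ 2 := by positivity
        nlinarith
      · refine hle' _ _ (2 * n + 1) 0 (2 * n + 1) (-n) (by simp) (by push_cast; ring) ?_
        have : 0 ≤ n * n ^ 2 := by positivity
        nlinarith
    · have hn4 := hn45.1
      have hω' : ω * ω = ω - n := by rw [hω]; simp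
      refine closure_ne_top hR (n : R) (2 * ω - 1) (-(2 * ω - 1)) 4 ?_ ?_ ?_ ?_ ?_ ?_ ?_ ?_ ?_ htop
      · have := hne n 0 (by positivity)
        simpa using this
      · have := hne (-1) 2 (by nlinarith)
        convert this using 1; push_cast; ring
      · linear_combination 4 * hω'
      · intro q
        obtain ⟨u, v, rfl⟩ := hs q
        refine hle' _ _ n 0 (n - u - 2 * n * v) (2 * u + v) (by simp) ?_ ?_
        · push_cast; linear_combination 2 * v * hω'
        · have h4 : 4 * n ^ 2 ≤ (2 * n - (4 * n - 1) * v) ^ 2 + (4 * n - 1) * (2 * u + v) ^ 2 := by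
            have h0 : 0 ≤ (4 * n - 1) * (2 * u + v) ^ 2 := mul_nonneg (by linarith) (sq_nonneg _)
            rcases (by omega : v ≤ -1 ∨ v = 0 ∨ v = 1 ∨ 2 ≤ v) with hv | rfl | rfl | hv
            · have : 2 * n ≤ 2 * n - (4 * n - 1) * v := by nlinarith
              nlinarith
            · nlinarith
            · have : 1 ≤ (2 * u + 1) ^ 2 := by
                have : 0 ≤ u * (u + 1) := by
                  rcases le_or_gt 0 u with h | h
                  · positivity
                  · exact mul_nonneg_of_nonpos_of_nonpos h.le (by omega)
                nlinarith
              nlinarith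
            · have : 6 * n - 2 ≤ (4 * n - 1) * v - 2 * n := by nlinarith
              nlinarith
          nlinarith
      · intro q
        obtain ⟨u, v, rfl⟩ := hs q
        refine hle' _ _ (-1) 2 (u * n - 1) (2 + v * n) (by push_cast; ring) ?_ ?_
        · push_cast; ring
        · have h4 : 4 ≤ (2 + v * n) ^ 2 := by
            have : 0 ≤ v * (v * n + 4) := by
              rcases le_or_gt 0 v with h | h
              · positivity
              · exact mul_nonneg_of_nonpos_of_nonpos h.le (by nlinarith)
            nlinarith
          have h5 : 0 ≤ (n * (2 * u + v)) ^ 2 := sq_nonneg _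
          nlinarith
      · refine hle' _ _ (-1) 2 (n - 1) 2 (by push_cast; ring) (by push_cast; ring) (by nlinarith)
      · refine hle' _ _ (-1) 2 (n + 1) (-2) (by push_cast; ring) (by push_cast; ring) (by nlinarith)
      · refine hle' _ _ n 0 (n - 1) 2 (by simp) (by push_cast; ring) (by nlinarith)
      · refine hle' _ _ n 0 (n + 1) (-2) (by simp) (by push_cast; ring) (by nlinarith)
  · intro hmem
    have hD12 : -12 < t ^ 2 - 4 * n := by
      simp only [Set.mem_insert_iff, Set.mem_singleton_iff] at hmem
      omega
    have hNat : ∀ r : R, ∃ k : ℕ, ‖f r‖ ^ 2 = k := by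
      intro r
      obtain ⟨u, v, rfl⟩ := hs r
      have h := hN u v
      have h0 : 0 ≤ u ^ 2 + t * u * v + n * v ^ 2 := by
        have : (0 : ℝ) ≤ ((u ^ 2 + t * u * v + n * v ^ 2 : ℤ) : ℝ) := by rw [← h]; positivity
        exact_mod_cast this
      obtain ⟨k, hk⟩ := Int.eq_ofNat_of_zero_le h0
      exact ⟨k, by rw [h, hk]; simp⟩
    choose N hNN using hNat
    apply closure_eq_top_of_euclid N
    intro a b hb
    have hfb : f b ≠ 0 := by rwa [Ne, map_eq_zero_iff f hf]
    obtain ⟨z, hz⟩ : ∃ z, z = f a / f b := ⟨_, rfl⟩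
    obtain ⟨v, hv⟩ : ∃ v : ℤ, |z.im / (f ω).im - v| ≤ 1 / 2 := ⟨_, abs_sub_round _⟩
    obtain ⟨u, hu⟩ : ∃ u : ℤ, |(z.re - v * (t / 2)) - u| ≤ 1 / 2 := ⟨_, abs_sub_round _⟩
    refine ⟨u + v * ω, ?_⟩
    have h1 : ‖z - f (u + v * ω)‖ ^ 2 < 1 := by
      rw [Complex.sq_norm, Complex.normSq_apply]
      simp [hre]
      have e1 : z.im - v * (f ω).im = (f ω).im * (z.im / (f ω).im - v) := by field_simp
      rw [e1]
      have hu2 := sq_le_sq' (abs_le.1 hu).1 (abs_le.1 hu).2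
      have hv2 := sq_le_sq' (abs_le.1 hv).1 (abs_le.1 hv).2
      have hD' : (f ω).im ^ 2 < 3 := by
        have : ((-12 : ℤ) : ℝ) < ((t ^ 2 - 4 * n : ℤ) : ℝ) := by exact_mod_cast hD12
        push_cast at this
        rw [him2]; linarith
      have := mul_le_mul_of_nonneg_left hv2 (sq_nonneg (f ω).im)
      nlinarith
    have h2 : f (a - (u + v * ω) * b) = (z - f (u + v * ω)) * f b := by
      rw [hz, map_sub, map_mul]; field_simp
    have h3 : (N (a - (u + v * ω) * b) : ℝ) < N b := by
      rw [← hNN, ← hNN, h2, norm_mul, mul_pow]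
      have : 0 < ‖f b‖ ^ 2 := by positivity
      nlinarith
    exact_mod_cast h3
/-- For an imaginary quadratic number field `K`, the group `SL(2, 𝒪_K)`
is generated by its upper and lower triangular matrices iff the discriminant of `K`
is one of `−3, −4, −7, −8, −11`. -/
theorem sl2_ring_of_integers_generated_iff
    (K : Type*) [Field K] [NumberField K]
    (hdeg : Module.finrank ℚ K = 2) (himag : IsEmpty (K →+* ℝ)) :
    (Subgroup.closure
      {M : Matrix.SpecialLinearGroup (Fin 2) (NumberField.RingOfIntegers K) |
        (M : Matrix (Fin 2) (Fin 2) (NumberField.RingOfIntegers K)) 1 0 = 0 ∨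
        (M : Matrix (Fin 2) (Fin 2) (NumberField.RingOfIntegers K)) 0 1 = 0} = ⊤) ↔
      NumberField.discr K ∈ ({-3, -4, -7, -8, -11} : Set ℤ) := by
  obtain ⟨ω, t, n, ht, hω, hs, hdisc⟩ := exists_omega K hdeg
  obtain ⟨φ⟩ : Nonempty (K →+* ℂ) := inferInstance
  have him := omega_im_ne K himag φ ω hs
  rw [hdisc]
  have hωK : (ω : K) * ω = t * ω - n := by
    have := congrArg (algebraMap (NumberField.RingOfIntegers K) K) hω
    simpa using this
  have hpar : ∀ (j : NumberField.RingOfIntegers K) (m : ℤ), m + ω = j + j → False := by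
    intro j m hj
    obtain ⟨u, v, rfl⟩ := hs j
    have h1 := congrArg (fun r : NumberField.RingOfIntegers K => (φ r).im) hj
    simp at h1
    have h2 : (φ ω).im * (1 - 2 * v) = 0 := by linear_combination h1
    rcases mul_eq_zero.1 h2 with h | h
    · exact him h
    · have : (1 - 2 * v : ℤ) = 0 := by exact_mod_cast h
      omega
  refine main_aux (φ.comp (algebraMap (NumberField.RingOfIntegers K) K))
    (φ.injective.comp NumberField.RingOfIntegers.coe_injective) ω t n ht hω hs him ?_ ?_ ?_ ?_
  · rintro ⟨j, hj, -⟩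
    exact hpar j 1 (by simpa using hj)
  · rintro ⟨j, hj, -⟩
    exact hpar j 0 (by simpa using hj)
  · rintro rfl rfl
    have hint : IsIntegral ℤ ((1 + (ω : K)) / 2) := by
      apply IsIntegral.of_pow (n := 3) (by norm_num)
      have : ((1 + (ω : K)) / 2) ^ 3 = -1 := by
        push_cast at hωK
        linear_combination (3 + (ω : K)) / 8 * hωK
      rw [this]
      exact isIntegral_one.neg
    obtain ⟨j, hj⟩ : ∃ j : NumberField.RingOfIntegers K, (j : K) = (1 + (ω : K)) / 2 := ⟨⟨_, hint⟩, rfl⟩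
    refine ⟨j, NumberField.RingOfIntegers.coe_injective ?_⟩
    simp only [map_add, map_one, hj]
    ring
  · rintro rfl rfl
    have hint : IsIntegral ℤ ((ω : K) / 2) := by
      apply IsIntegral.of_pow (n := 2) (by norm_num)
      have : ((ω : K) / 2) ^ 2 = -1 := by
        push_cast at hωK
        linear_combination 1 / 4 * hωK
      rw [this]
      exact isIntegral_one.neg
    obtain ⟨j, hj⟩ : ∃ j : NumberField.RingOfIntegers K, (j : K) = (ω : K) / 2 := ⟨⟨_, hint⟩, rfl⟩
    refine ⟨j, NumberField.RingOfIntegers.coe_injective ?_⟩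
    simp only [map_add, map_one, hj]
    ring
end
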